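/- Let S_d be the standard simplex in ℝ^d. There exist linear functionals α(θ,V,J), indexed by θ ∈ Θ_d, V ∈ {1,2}^d and multi-indices J ∈ ℕ^d, with the following properties. (i) For every integer w ≥ 1, every g ∈ C^{w+1}(ℝ^d), every θ ∈ Θ_d and every ξ ∈ Q(θ): the Fourier transform satisfies (g χ_{S_d})^(ξ) = Σ_{V∈{1,2}^d} Σ_{|J|≤w} ⟨α(θ,V,J), g⟩ e^{−2πiλ_V·ξ} / Π_{b_k ∈ B_V∖θ} (2πi b_k·ξ)^{j_k+1} + R_{θ,w}(g,ξ), where B_V = {b_1,…,b_d} is the basis associated with V and j_k = 0 whenever b_k ∈ θ. (ii) |⟨α(θ,V,J), g⟩| ≤ c · 2^{(d−1)|J|} · sup_{|α|≤|J|} sup_{x∈S_d} |∂^α g(x)| for a constant c independent of g. (iii) For every Ω > 1/(2π) and every τ_0 > 0 there exists U > 0 such that for every τ > τ_0 and every w ≥ 1, the sequence { χ_{Q(θ)}(n) R_{θ,w}(g, τn) }_{n∈ℤ^d} is the sequence of Fourier coefficients of a function on the torus 𝕋^d bounded in sup norm by U (2^{d−1} Ω τ^{−1})^{w+1} sup_{w−d+2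 ≤ |α| ≤ w+1} sup_{x∈S_d} |∂^α g(x)|. -/

import Mathlib

open scoped Real
open MeasureTheory

/-- The `k`-th vector of the basis `B_v ∈ F^{(d)}` indexed by `v` (only the components
`v_2,…,v_d` matter; `v m = true` encodes `v_m = 2`).  Explicitly, `b_k = e_k - e_m` where
`m` is the least index `m > k` with `v_m = 2`, and `b_k = e_k` if there is no such `m`.
This closed form agrees with the recursive definition of the families `F^{(d)}`. -/
def baseVec (d : ℕ) (v : Fin d → Bool) (k : Fin d) : Fin d → ℝ := fun i =>
  (if i = k then (1 : ℝ) else 0) -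
    (if k < i ∧ v i = true ∧ (∀ m : Fin d, k < m → v m = true → i ≤ m) then (1 : ℝ) else 0)

/-- The set of all vectors occurring in the bases of `F^{(d)}`. -/
def allBaseVecs (d : ℕ) : Set (Fin d → ℝ) := {b | ∃ v k, b = baseVec d v k}

/-- `Θ_d`: all subspaces of `ℝ^d` spanned by sets of vectors from the bases of `F^{(d)}`. -/
def Theta (d : ℕ) : Set (Submodule ℝ (Fin d → ℝ)) :=
  {θ | ∃ s : Set (Fin d → ℝ), s ⊆ allBaseVecs d ∧ θ = Submodule.span ℝ s}

/-- The cone `Q(θ)`: points orthogonal exactly to the basis vectors lying in `θ`. -/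
def Qcone (d : ℕ) (θ : Submodule ℝ (Fin d → ℝ)) : Set (Fin d → ℝ) :=
  {ξ | ∀ b ∈ allBaseVecs d, ((∑ i, ξ i * b i) = 0 ↔ b ∈ θ)}

/-- The vector `λ_V`: in closed form, `λ_V = e_k` where `k` is the least index with
`v_k = 2` (encoded `v k = true`), and `λ_V = 0` if there is no such index.  This agrees
with the recursive definition. -/
def lamV (d : ℕ) (v : Fin d → Bool) : Fin d → ℝ := fun i =>
  if v i = true ∧ (∀ j : Fin d, v j = true → i ≤ j) then 1 else 0

/-- The standard simplex `S_d`. -/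
def Sd (d : ℕ) : Set (Fin d → ℝ) := {x | (∀ j, 0 ≤ x j) ∧ ∑ j, x j ≤ 1}

/-- The Fourier transform `f̂(ξ) = ∫ f(v) e^{-2πi ξ·v} dv` on `ℝ^d`. -/
noncomputable def ft (d : ℕ) (f : (Fin d → ℝ) → ℂ) (ξ : Fin d → ℝ) : ℂ :=
  ∫ v, f v * Complex.exp (-2 * π * Complex.I * (∑ i, ξ i * v i))

/-- Fourier coefficient of a `ℤ^d`-periodic function on the torus:
`F̂(m) = ∫_{[0,1)^d} F(x) e^{-2πi m·x} dx`. -/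
noncomputable def tFC (d : ℕ) (F : (Fin d → ℝ) → ℂ) (m : Fin d → ℤ) : ℂ :=
  ∫ x in Set.univ.pi (fun _ : Fin d => Set.Ico (0 : ℝ) 1),
    F x * Complex.exp (-2 * π * Complex.I * (∑ i, (m i : ℝ) * x i))

/-- The partial derivative `∂/∂x_i`. -/
noncomputable def pderivI (d : ℕ) (i : Fin d) (g : (Fin d → ℝ) → ℝ) : (Fin d → ℝ) → ℝ :=
  fun x => fderiv ℝ g x (Pi.single i 1)

/-- The multi-index partial derivative `∂^β = ∏_i (∂/∂x_i)^{β_i}`. -/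
noncomputable def pderivM (d : ℕ) (β : Fin d → ℕ) (g : (Fin d → ℝ) → ℝ) :
    (Fin d → ℝ) → ℝ :=
  ((List.finRange d).map fun i => (pderivI d i)^[β i]).foldr (· ∘ ·) id g

/-- The continuous linear map `(x, t) ↦ (x_1, …, x_d, t)`. -/
noncomputable def snocCLM (d : ℕ) : (Fin d → ℝ) × ℝ →L[ℝ] (Fin (d + 1) → ℝ) :=
  LinearMap.toContinuousLinearMap
    { toFun := fun p => Fin.snoc (α := fun _ => ℝ) p.1 p.2
      map_add' := fun p q => by
        funext i
        refine Fin.lastCases ?_ (fun i => ?_) i <;> simp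
      map_smul' := fun c p => by
        funext i
        refine Fin.lastCases ?_ (fun i => ?_) i <;> simp }

@[simp]
theorem snocCLM_castSucc {d : ℕ} (p : (Fin d → ℝ) × ℝ) (i : Fin d) :
    snocCLM d p i.castSucc = p.1 i := by
  simp [snocCLM]

@[simp]
theorem snocCLM_last {d : ℕ} (p : (Fin d → ℝ) × ℝ) :
    snocCLM d p (Fin.last d) = p.2 := by
  simp [snocCLM]

theorem snocCLM_single_zero {d : ℕ} (k : Fin d) :
    snocCLM d (Pi.single k 1, 0) = Pi.single k.castSucc 1 := by
  funext i
  refine Fin.lastCases ?_ (fun i => ?_) i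
  · rw [snocCLM_last, Pi.single_eq_of_ne (Fin.castSucc_lt_last k).ne']
  · simp [Pi.single_apply]

theorem snocCLM_zero_one {d : ℕ} :
    snocCLM d (0, 1) = Pi.single (Fin.last d) 1 := by
  funext i
  refine Fin.lastCases ?_ (fun i => ?_) i
  · simp
  · rw [snocCLM_castSucc, Pi.single_eq_of_ne (Fin.castSucc_lt_last i).ne]; rfl

/-- Restriction of a function on `ℝ^{d+1}` to the face `x_{d+1} = 0`. -/
noncomputable def faceZero (d : ℕ) (g : (Fin (d + 1) → ℝ) → ℝ) : (Fin d → ℝ) → ℝ :=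
  fun x => g (snocCLM d (x, 0))

/-- Restriction of a function on `ℝ^{d+1}` to the face `x_1 + ⋯ + x_{d+1} = 1`. -/
noncomputable def faceSum (d : ℕ) (g : (Fin (d + 1) → ℝ) → ℝ) : (Fin d → ℝ) → ℝ :=
  fun x => g (snocCLM d (x, 1 - ∑ i, x i))

/-- Integral of a function over the fibres of the projection of the simplex that forgets the last
coordinate. -/
noncomputable def fiberIntegral (d : ℕ) (g : (Fin (d + 1) → ℝ) → ℝ) : (Fin d → ℝ) → ℝ :=
  fun x => ∫ t in (0 : ℝ)..(1 - ∑ i, x i), g (snocCLM d (x, t))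

/-- Iterated partial derivatives along a list of coordinates, the head being applied first. -/
noncomputable def pderivL (d : ℕ) : List (Fin d) → ((Fin d → ℝ) → ℝ) → (Fin d → ℝ) → ℝ
  | [], g => g
  | i :: l, g => pderivL d l (pderivI d i g)

section PartialDerivatives

variable {d : ℕ}

theorem ContDiff.pderivI {n : ℕ} {g : (Fin d → ℝ) → ℝ} (hg : ContDiff ℝ (n + 1 : ℕ) g)
    (i : Fin d) : ContDiff ℝ n (pderivI d i g) := by
  have h : ContDiff ℝ n (fderiv ℝ g) := hg.fderiv_right (by norm_cast)
  exact h.clm_apply contDiff_const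

theorem ContDiff.pderivI_iterate {n j : ℕ} {g : (Fin d → ℝ) → ℝ}
    (hg : ContDiff ℝ (n + j : ℕ) g) (i : Fin d) : ContDiff ℝ n ((_root_.pderivI d i)^[j] g) := by
  induction j generalizing g with
  | zero => simpa using hg
  | succ j ih =>
    rw [Function.iterate_succ_apply]
    exact ih (ContDiff.pderivI (n := n + j) hg i)

theorem ContDiff.pderivL {n : ℕ} {g : (Fin d → ℝ) → ℝ} (l : List (Fin d))
    (hg : ContDiff ℝ (n + l.length : ℕ) g) : ContDiff ℝ n (pderivL d l g) := by
  induction l generalizing g with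
  | nil => exact hg
  | cons i l ih => exact ih (ContDiff.pderivI (n := n + l.length) hg i)

theorem differentiable_of_contDiff_succ {E : Type*} [NormedAddCommGroup E] [NormedSpace ℝ E]
    {n : ℕ} {g : E → ℝ} (hg : ContDiff ℝ (n + 1 : ℕ) g) : Differentiable ℝ g :=
  hg.differentiable (by simp)

theorem pderivI_sub {f g : (Fin d → ℝ) → ℝ} (hf : Differentiable ℝ f) (hg : Differentiable ℝ g)
    (i : Fin d) : pderivI d i (f - g) = pderivI d i f - pderivI d i g := by
  funext x
  simp [pderivI, fderiv_sub (hf x) (hg x)]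

theorem pderivI_add {f g : (Fin d → ℝ) → ℝ} (hf : Differentiable ℝ f) (hg : Differentiable ℝ g)
    (i : Fin d) : pderivI d i (f + g) = pderivI d i f + pderivI d i g := by
  funext x
  simp [pderivI, fderiv_add (hf x) (hg x)]

theorem pderivI_smul (c : ℝ) {f : (Fin d → ℝ) → ℝ} (hf : Differentiable ℝ f)
    (i : Fin d) : pderivI d i (c • f) = c • pderivI d i f := by
  funext x
  simp [pderivI, fderiv_const_smul (hf x)]

theorem pderivI_iterate_add {j : ℕ} {f g : (Fin d → ℝ) → ℝ} (hf : ContDiff ℝ j f)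
    (hg : ContDiff ℝ j g) (i : Fin d) :
    (pderivI d i)^[j] (f + g) = (pderivI d i)^[j] f + (pderivI d i)^[j] g := by
  induction j generalizing f g with
  | zero => rfl
  | succ j ih =>
    simp only [Function.iterate_succ_apply]
    rw [pderivI_add (differentiable_of_contDiff_succ hf) (differentiable_of_contDiff_succ hg),
      ih (hf.pderivI i) (hg.pderivI i)]

theorem pderivI_iterate_smul {j : ℕ} (c : ℝ) {f : (Fin d → ℝ) → ℝ} (hf : ContDiff ℝ j f)
    (i : Fin d) : (pderivI d i)^[j] (c • f) = c • (pderivI d i)^[j] f := by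
  induction j generalizing f with
  | zero => rfl
  | succ j ih =>
    simp only [Function.iterate_succ_apply]
    rw [pderivI_smul c (differentiable_of_contDiff_succ hf), ih (hf.pderivI i)]

theorem pderivL_sub {f g : (Fin d → ℝ) → ℝ} (l : List (Fin d)) (hf : ContDiff ℝ l.length f)
    (hg : ContDiff ℝ l.length g) : pderivL d l (f - g) = pderivL d l f - pderivL d l g := by
  induction l generalizing f g with
  | nil => rfl
  | cons i l ih =>
    rw [List.length_cons] at hf hg
    simp only [pderivL]
    rw [pderivI_sub (differentiable_of_contDiff_succ hf) (differentiable_of_contDiff_succ hg),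
      ih (hf.pderivI i) (hg.pderivI i)]

theorem pderivI_comm {g : (Fin d → ℝ) → ℝ} (hg : ContDiff ℝ 2 g) (i j : Fin d) :
    pderivI d i (pderivI d j g) = pderivI d j (pderivI d i g) := by
  funext x
  have hd : Differentiable ℝ (fderiv ℝ g) :=
    (hg.fderiv_right (m := 1) (by norm_num)).differentiable (by simp)
  have key : ∀ a b : Fin d, pderivI d a (pderivI d b g) x
      = fderiv ℝ (fderiv ℝ g) x (Pi.single a 1) (Pi.single b 1) := by
    intro a b
    change fderiv ℝ (fun y => fderiv ℝ g y (Pi.single b 1)) x (Pi.single a 1) = _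
    rw [fderiv_clm_apply (hd x) (differentiableAt_const _)]
    simp
  rw [key, key]
  exact (hg.contDiffAt.isSymmSndFDerivAt (by simp)).eq _ _

theorem pderivL_perm {l l' : List (Fin d)} (h : l.Perm l') {g : (Fin d → ℝ) → ℝ}
    (hg : ContDiff ℝ l.length g) : pderivL d l g = pderivL d l' g := by
  induction h generalizing g with
  | nil => rfl
  | cons i _ ih => exact ih (ContDiff.pderivI hg i)
  | swap i j l =>
    simp only [pderivL]
    rw [pderivI_comm (hg.of_le _)]
    simp only [List.length_cons]
    norm_cast
    omega
  | trans h₁ _ ih₁ ih₂ =>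
    rw [ih₁ hg, ih₂ (h₁.length_eq ▸ hg)]

theorem pderivL_append (l l' : List (Fin d)) (g : (Fin d → ℝ) → ℝ) :
    pderivL d (l ++ l') g = pderivL d l' (pderivL d l g) := by
  induction l generalizing g with
  | nil => rfl
  | cons i l ih => exact ih _

theorem pderivL_replicate (n : ℕ) (i : Fin d) (g : (Fin d → ℝ) → ℝ) :
    pderivL d (List.replicate n i) g = (pderivI d i)^[n] g := by
  induction n generalizing g with
  | zero => rfl
  | succ n ih => rw [List.replicate_succ, Function.iterate_succ_apply]; exact ih _

/-- The coordinates of a multi-index, listed with multiplicity in the order in which `pderivM`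
differentiates. -/
def multiIndexList (d : ℕ) (β : Fin d → ℕ) : List (Fin d) :=
  ((List.finRange d).reverse.map fun i => List.replicate (β i) i).flatten

theorem pderivM_eq_pderivL (β : Fin d → ℕ) (g : (Fin d → ℝ) → ℝ) :
    pderivM d β g = pderivL d (multiIndexList d β) g := by
  have h : ∀ l : List (Fin d), (l.map fun i => (pderivI d i)^[β i]).foldr (· ∘ ·) id g
      = pderivL d (l.reverse.map fun i => List.replicate (β i) i).flatten g := by
    intro l
    induction l with
    | nil => rfl
    | cons i l ih =>
      simp only [List.map_cons, List.foldr_cons, Function.comp_apply, ih, List.reverse_cons,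
        List.map_append, List.map_nil, List.flatten_append, pderivL_append, List.flatten_cons,
        List.flatten_nil, List.append_nil, pderivL_replicate]
  exact h _

theorem count_multiIndexList (β : Fin d → ℕ) (i : Fin d) :
    (multiIndexList d β).count i = β i := by
  have h : ∀ l : List (Fin d), l.Nodup →
      (l.map fun i => List.replicate (β i) i).flatten.count i = if i ∈ l then β i else 0 := by
    intro l hl
    induction l with
    | nil => simp
    | cons j l ih =>
      rw [List.nodup_cons] at hl
      simp only [List.map_cons, List.flatten_cons, List.count_append, ih hl.2,
        List.count_replicate, List.mem_cons]
      by_cases hij : i = j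
      · subst hij; simp [hl.1]
      · simp [hij, Ne.symm hij]
  rw [multiIndexList, h _ (List.nodup_reverse.2 (List.nodup_finRange d))]
  simp

theorem pderivL_eq_pderivM (l : List (Fin d)) {g : (Fin d → ℝ) → ℝ}
    (hg : ContDiff ℝ l.length g) : pderivL d l g = pderivM d (fun i => l.count i) g := by
  rw [pderivM_eq_pderivL]
  refine pderivL_perm (List.perm_iff_count.2 fun i => ?_) hg
  rw [count_multiIndexList]

theorem sum_count_eq_length (l : List (Fin d)) : ∑ i, l.count i = l.length := by
  rw [← Multiset.coe_card, ← Multiset.sum_count_eq_card (s := Finset.univ) (by simp)]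
  simp

end PartialDerivatives

section Faces

variable {d : ℕ}

theorem contDiff_faceZero {n : ℕ∞} {g : (Fin (d + 1) → ℝ) → ℝ} (hg : ContDiff ℝ n g) :
    ContDiff ℝ n (faceZero d g) :=
  hg.comp ((snocCLM d).contDiff.comp (contDiff_id.prodMk contDiff_const))

theorem contDiff_faceSum {n : ℕ∞} {g : (Fin (d + 1) → ℝ) → ℝ} (hg : ContDiff ℝ n g) :
    ContDiff ℝ n (faceSum d g) := by
  refine hg.comp ((snocCLM d).contDiff.comp (contDiff_id.prodMk ?_))
  fun_prop

theorem pderivI_faceZero {g : (Fin (d + 1) → ℝ) → ℝ} (hg : Differentiable ℝ g) (k : Fin d) :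
    pderivI d k (faceZero d g) = faceZero d (pderivI (d + 1) k.castSucc g) := by
  funext x
  have h : HasFDerivAt (faceZero d g)
      ((fderiv ℝ g (snocCLM d (x, 0))).comp ((snocCLM d).comp
        ((ContinuousLinearMap.id ℝ (Fin d → ℝ)).prod 0))) x :=
    (hg _).hasFDerivAt.comp x ((snocCLM d).hasFDerivAt.comp x
      ((hasFDerivAt_id x).prodMk (hasFDerivAt_const (0 : ℝ) x)))
  simp [pderivI, h.fderiv, faceZero, snocCLM_single_zero]

theorem hasFDerivAt_one_sub_sum (x : Fin d → ℝ) :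
    HasFDerivAt (fun x : Fin d → ℝ => 1 - ∑ i, x i)
      (-∑ i, ContinuousLinearMap.proj (R := ℝ) (φ := fun _ : Fin d => ℝ) i) x := by
  have h := (HasFDerivAt.fun_sum (u := Finset.univ) fun (i : Fin d) _ =>
    (ContinuousLinearMap.proj (R := ℝ) (φ := fun _ : Fin d => ℝ) i).hasFDerivAt (x := x))
  exact h.const_sub 1

theorem pderivI_faceSum {g : (Fin (d + 1) → ℝ) → ℝ} (hg : Differentiable ℝ g) (k : Fin d) :
    pderivI d k (faceSum d g) = faceSum d (pderivI (d + 1) k.castSucc g)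
      - faceSum d (pderivI (d + 1) (Fin.last d) g) := by
  funext x
  have h : HasFDerivAt (faceSum d g)
      ((fderiv ℝ g (snocCLM d (x, 1 - ∑ i, x i))).comp ((snocCLM d).comp
        ((ContinuousLinearMap.id ℝ (Fin d → ℝ)).prod
          (-∑ i, ContinuousLinearMap.proj (R := ℝ) (φ := fun _ : Fin d => ℝ) i)))) x :=
    (hg _).hasFDerivAt.comp x ((snocCLM d).hasFDerivAt.comp x
      ((hasFDerivAt_id x).prodMk (hasFDerivAt_one_sub_sum x)))
  have e : ((Pi.single k 1, -1) : (Fin d → ℝ) × ℝ) = (Pi.single k 1, 0) - (0, 1) := by simp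
  simp [pderivI, h.fderiv, faceSum]
  rw [e, map_sub, map_sub, snocCLM_single_zero, snocCLM_zero_one]

/-- The primitive `(x, u) ↦ ∫_0^u g(x, t) dt` of a `C^1` function is strictly differentiable. -/
theorem hasStrictFDerivAt_parametric_primitive {g : (Fin (d + 1) → ℝ) → ℝ} (hg : ContDiff ℝ 1 g)
    (p : (Fin d → ℝ) × ℝ) :
    HasStrictFDerivAt (fun q : (Fin d → ℝ) × ℝ => ∫ t in (0 : ℝ)..q.2, g (snocCLM d (q.1, t)))
      ((∫ t in (0 : ℝ)..p.2, (fderiv ℝ g (snocCLM d (p.1, t))).comp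
          ((snocCLM d).comp (ContinuousLinearMap.inl ℝ (Fin d → ℝ) ℝ))).coprod
        (ContinuousLinearMap.toSpanSingleton ℝ (g (snocCLM d p)))) p := by
  have hgc : Continuous g := hg.continuous
  have hgd : Continuous (fderiv ℝ g) := hg.continuous_fderiv (by simp)
  let A : (Fin d → ℝ) → ℝ → (Fin d → ℝ) →L[ℝ] ℝ := fun x t =>
    (fderiv ℝ g (snocCLM d (x, t))).comp
          ((snocCLM d).comp (ContinuousLinearMap.inl ℝ (Fin d → ℝ) ℝ))
  have hA : Continuous A.uncurry := by
    refine Continuous.clm_comp (hgd.comp ?_) continuous_const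
    exact (snocCLM d).continuous
  have hF : Continuous (fun q : (Fin d → ℝ) × ℝ => g (snocCLM d (q.1, q.2))) :=
    hgc.comp (snocCLM d).continuous
  refine hasStrictFDerivAt_uncurry_coprod
    (f := fun x u => ∫ t in (0 : ℝ)..u, g (snocCLM d (x, t)))
    (f₁ := fun x u => ∫ t in (0 : ℝ)..u, A x t)
    (f₂ := fun x u => ContinuousLinearMap.toSpanSingleton ℝ (g (snocCLM d (x, u)))) ?_ ?_ ?_ ?_
  · refine Filter.Eventually.of_forall fun v => ?_
    obtain ⟨x, u⟩ := v
    obtain ⟨C, hC⟩ := ((isCompact_closedBall x 1).prod (isCompact_uIcc (a := (0:ℝ)) (b := u))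
      ).exists_bound_of_continuousOn (f := A.uncurry) hA.continuousOn
    refine intervalIntegral.hasFDerivAt_integral_of_dominated_of_fderiv_le
      (s := Metric.closedBall x 1) (bound := fun _ => C) (F' := A)
      (Metric.closedBall_mem_nhds x one_pos) ?_ ?_ ?_ ?_ ?_ ?_
    · exact Filter.Eventually.of_forall fun y =>
        (hF.comp (Continuous.prodMk_right y)).aestronglyMeasurable
    · exact (hF.comp (Continuous.prodMk_right x)).intervalIntegrable _ _
    · exact (hA.comp (Continuous.prodMk_right x)).aestronglyMeasurable
    · exact Filter.Eventually.of_forall fun t ht y hy =>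
        hC (y, t) ⟨hy, Set.uIoc_subset_uIcc ht⟩
    · exact intervalIntegrable_const
    · refine Filter.Eventually.of_forall fun t ht y hy => ?_
      have hd : HasFDerivAt g (fderiv ℝ g (snocCLM d (y, t))) (snocCLM d (y, t)) :=
        (hg.differentiable (by simp) _).hasFDerivAt
      exact hd.comp y ((snocCLM d).hasFDerivAt.comp y (hasFDerivAt_prodMk_left y t))
  · refine Filter.Eventually.of_forall fun v => ?_
    have hc := hF.comp (Continuous.prodMk_right v.1)
    exact (intervalIntegral.integral_hasDerivAt_right (hc.intervalIntegrable _ _)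
      (hc.stronglyMeasurableAtFilter _ _) hc.continuousAt).hasFDerivAt
  · exact (intervalIntegral.continuous_parametric_primitive_of_continuous hA).continuousAt
  · exact ((ContinuousLinearMap.toSpanSingletonLE ℝ ℝ ℝ).continuous_of_finiteDimensional.comp
      hF).continuousAt

theorem hasFDerivAt_fiberIntegral {g : (Fin (d + 1) → ℝ) → ℝ} (hg : ContDiff ℝ 1 g)
    (x : Fin d → ℝ) :
    HasFDerivAt (fiberIntegral d g)
      (∑ k, (fiberIntegral d (pderivI (d + 1) k.castSucc g) x - faceSum d g x) •
        ContinuousLinearMap.proj (R := ℝ) (φ := fun _ : Fin d => ℝ) k) x := by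
  have hgd : Continuous (fderiv ℝ g) := hg.continuous_fderiv (by simp)
  have h := (hasStrictFDerivAt_parametric_primitive hg (x, 1 - ∑ i, x i)).hasFDerivAt.comp x
    ((hasFDerivAt_id x).prodMk (hasFDerivAt_one_sub_sum x))
  refine h.congr_fderiv ?_
  ext1 v
  have hI : (∫ t in (0 : ℝ)..(1 - ∑ i, x i), (fderiv ℝ g (snocCLM d (x, t))).comp
        ((snocCLM d).comp (ContinuousLinearMap.inl ℝ (Fin d → ℝ) ℝ))) v
      = ∫ t in (0 : ℝ)..(1 - ∑ i, x i), fderiv ℝ g (snocCLM d (x, t)) (snocCLM d (v, 0)) := by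
    rw [ContinuousLinearMap.intervalIntegral_apply]
    · rfl
    · refine Continuous.intervalIntegrable ?_ _ _
      refine Continuous.clm_comp (hgd.comp ?_) continuous_const
      exact (snocCLM d).continuous.comp (Continuous.prodMk_right x)
  have hv : snocCLM d (v, 0) = ∑ k, v k • (Pi.single k.castSucc 1 : Fin (d + 1) → ℝ) := by
    funext i
    refine Fin.lastCases ?_ (fun i => ?_) i
    · simp [Finset.sum_apply, (Fin.castSucc_lt_last _).ne']
    · simp [Finset.sum_apply, Pi.single_apply]
  have hS : (∫ t in (0 : ℝ)..(1 - ∑ i, x i), fderiv ℝ g (snocCLM d (x, t)) (snocCLM d (v, 0)))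
      = ∑ k, v k * fiberIntegral d (pderivI (d + 1) k.castSucc g) x := by
    simp only [hv, map_sum, map_smul, smul_eq_mul]
    rw [intervalIntegral.integral_finsetSum]
    · simp only [intervalIntegral.integral_const_mul]
      rfl
    · intro k _
      refine Continuous.intervalIntegrable ?_ _ _
      refine continuous_const.mul ((hgd.comp ?_).clm_apply continuous_const)
      exact (snocCLM d).continuous.comp (Continuous.prodMk_right x)
  simp only [ContinuousLinearMap.comp_apply, ContinuousLinearMap.coprod_apply,
    ContinuousLinearMap.prod_apply, ContinuousLinearMap.id_apply]
  rw [hI, hS]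
  simp [faceSum, mul_sub, Finset.sum_sub_distrib, Finset.sum_mul, mul_comm, ← sub_eq_add_neg]

theorem pderivI_fiberIntegral {g : (Fin (d + 1) → ℝ) → ℝ} (hg : ContDiff ℝ 1 g) (k : Fin d) :
    pderivI d k (fiberIntegral d g)
      = fiberIntegral d (pderivI (d + 1) k.castSucc g) - faceSum d g := by
  funext x
  simp [pderivI, (hasFDerivAt_fiberIntegral hg x).fderiv, Pi.single_apply]

theorem contDiff_fiberIntegral {n : ℕ} {g : (Fin (d + 1) → ℝ) → ℝ} (hg : ContDiff ℝ n g) :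
    ContDiff ℝ n (fiberIntegral d g) := by
  induction n generalizing g with
  | zero =>
    refine contDiff_zero.2 (intervalIntegral.continuous_parametric_intervalIntegral_of_continuous
      (f := fun x t => g (snocCLM d (x, t))) ?_ (by fun_prop))
    exact hg.continuous.comp (snocCLM d).continuous
  | succ n ih =>
    have h1 : ContDiff ℝ 1 g := hg.of_le (by norm_cast; omega)
    have hn : ContDiff ℝ n g := hg.of_le (by norm_cast; omega)
    push_cast
    refine contDiff_succ_iff_hasFDerivAt.2 ⟨_, ?_, hasFDerivAt_fiberIntegral h1⟩
    refine ContDiff.sum fun k _ => ContDiff.fun_smul (ContDiff.sub ?_ ?_) contDiff_const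
    · exact ih (hg.pderivI _)
    · exact contDiff_faceSum (n := n) hn

theorem snocCLM_faceZero_mem {x : Fin d → ℝ} (hx : x ∈ Sd d) : snocCLM d (x, 0) ∈ Sd (d + 1) := by
  refine ⟨fun j => Fin.lastCases (by simp) (fun i => by simpa using hx.1 i) j, ?_⟩
  simpa [Fin.sum_univ_castSucc] using hx.2

theorem snocCLM_mem {x : Fin d → ℝ} {t : ℝ} (hx : x ∈ Sd d) (ht : 0 ≤ t) (ht' : t ≤ 1 - ∑ i, x i) :
    snocCLM d (x, t) ∈ Sd (d + 1) := by
  refine ⟨fun j => Fin.lastCases (by simpa using ht) (fun i => by simpa using hx.1 i) j, ?_⟩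
  simp only [Fin.sum_univ_castSucc, snocCLM_castSucc, snocCLM_last]
  linarith

theorem snocCLM_faceSum_mem {x : Fin d → ℝ} (hx : x ∈ Sd d) :
    snocCLM d (x, 1 - ∑ i, x i) ∈ Sd (d + 1) :=
  snocCLM_mem hx (by linarith [hx.2]) le_rfl

theorem pderivL_faceZero (l : List (Fin d)) {g : (Fin (d + 1) → ℝ) → ℝ}
    (hg : ContDiff ℝ l.length g) :
    pderivL d l (faceZero d g) = faceZero d (pderivL (d + 1) (l.map Fin.castSucc) g) := by
  induction l generalizing g with
  | nil => rfl
  | cons k l ih =>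
    simp only [pderivL, List.map_cons]
    rw [pderivI_faceZero (differentiable_of_contDiff_succ hg), ih (hg.pderivI _)]

/-- The factor by which restriction to the slanted face increases the size of a first order
derivative in `d` variables; there are no derivatives if `d = 0`. -/
noncomputable def slantFactor (d : ℕ) : ℝ := if d = 0 then 1 else 2

theorem one_le_slantFactor (d : ℕ) : 1 ≤ slantFactor d := by
  unfold slantFactor; split_ifs <;> norm_num

theorem slantFactor_eq_two (k : Fin d) : slantFactor d = 2 := by
  rw [slantFactor, if_neg (Nat.pos_iff_ne_zero.1 (Fin.pos k))]

theorem pow_mul_slantFactor (d : ℕ) : (2 : ℝ) ^ (d - 1) * slantFactor d = 2 ^ (d + 1 - 1) := by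
  rcases d with _ | d
  · simp [slantFactor]
  · simp [slantFactor, pow_succ]

theorem abs_pderivL_faceSum_le (l : List (Fin d)) {g : (Fin (d + 1) → ℝ) → ℝ}
    (hg : ContDiff ℝ l.length g) {M : ℝ}
    (hM : ∀ l' : List (Fin (d + 1)), l'.length = l.length → ∀ x ∈ Sd (d + 1),
      |pderivL (d + 1) l' g x| ≤ M) {x : Fin d → ℝ} (hx : x ∈ Sd d) :
    |pderivL d l (faceSum d g) x| ≤ slantFactor d ^ l.length * M := by
  induction l generalizing g with
  | nil => simpa [faceSum, pderivL] using hM [] rfl _ (snocCLM_faceSum_mem hx)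
  | cons k l ih =>
    rw [List.length_cons] at hg
    simp only [pderivL]
    have hc : ∀ i, ContDiff ℝ l.length (faceSum d (pderivI (d + 1) i g)) := fun i =>
      contDiff_faceSum (n := l.length) (hg.pderivI i)
    rw [pderivI_faceSum (differentiable_of_contDiff_succ hg), pderivL_sub l (hc _) (hc _)]
    have h : ∀ i, |pderivL d l (faceSum d (pderivI (d + 1) i g)) x|
        ≤ slantFactor d ^ l.length * M := fun i =>
      ih (hg.pderivI i) fun l' hl' => hM (i :: l') (by simp [hl'])
    calc _ ≤ _ := abs_sub _ _
      _ ≤ slantFactor d ^ l.length * M + slantFactor d ^ l.length * M := add_le_add (h _) (h _)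
      _ = slantFactor d ^ (k :: l).length * M := by
        rw [List.length_cons, pow_succ, slantFactor_eq_two k]; ring

theorem abs_pderivL_fiberIntegral_le (l : List (Fin d)) {g : (Fin (d + 1) → ℝ) → ℝ}
    (hg : ContDiff ℝ l.length g) {M : ℝ}
    (hM : ∀ l' : List (Fin (d + 1)), l'.length ≤ l.length → l.length ≤ l'.length + 1 →
      ∀ x ∈ Sd (d + 1), |pderivL (d + 1) l' g x| ≤ M) {x : Fin d → ℝ} (hx : x ∈ Sd d) :
    |pderivL d l (fiberIntegral d g) x| ≤ slantFactor d ^ l.length * M := by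
  induction l generalizing g with
  | nil =>
    have hs : 0 ≤ ∑ i, x i := Finset.sum_nonneg fun i _ => hx.1 i
    have h1 : 0 ≤ 1 - ∑ i, x i := by linarith [hx.2]
    have hM0 : 0 ≤ M := (abs_nonneg _).trans (hM [] le_rfl (by simp) _ (snocCLM_faceZero_mem hx))
    have := intervalIntegral.norm_integral_le_of_norm_le_const
      (f := fun t => g (snocCLM d (x, t))) (a := 0) (b := 1 - ∑ i, x i) (C := M) (fun t ht => by
        rw [Set.uIoc_of_le h1] at ht
        exact hM [] le_rfl (by simp) _ (snocCLM_mem hx ht.1.le ht.2))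
    simp only [pderivL, List.length_nil, pow_zero, one_mul, fiberIntegral]
    refine this.trans ?_
    rw [sub_zero, abs_of_nonneg h1]
    nlinarith
  | cons k l ih =>
    rw [List.length_cons] at hg
    have hl : ContDiff ℝ l.length g := hg.of_le (by norm_cast; omega)
    simp only [pderivL]
    rw [pderivI_fiberIntegral (hg.of_le (by norm_cast; omega)), pderivL_sub l
      (contDiff_fiberIntegral (hg.pderivI _)) (contDiff_faceSum (n := l.length) hl)]
    have h₁ : |pderivL d l (fiberIntegral d (pderivI (d + 1) k.castSucc g)) x|
        ≤ slantFactor d ^ l.length * M :=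
      ih (hg.pderivI _) fun l' h₁ h₂ => hM (k.castSucc :: l') (by simpa using h₁)
        (by simpa using h₂)
    have h₂ : |pderivL d l (faceSum d g) x| ≤ slantFactor d ^ l.length * M :=
      abs_pderivL_faceSum_le l hl (fun l' hl' => hM l' (by simp [hl']) (by simp [hl'])) hx
    calc _ ≤ _ := abs_sub _ _
      _ ≤ slantFactor d ^ l.length * M + slantFactor d ^ l.length * M := add_le_add h₁ h₂
      _ = slantFactor d ^ (k :: l).length * M := by
        rw [List.length_cons, pow_succ, slantFactor_eq_two k]; ring

end Faces

section FourierRecursion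

variable {d : ℕ}

theorem isCompact_Sd (d : ℕ) : IsCompact (Sd d) := by
  refine (isCompact_Icc (a := (0 : Fin d → ℝ)) (b := 1)).of_isClosed_subset ?_ ?_
  · have : Sd d = (⋂ j, {x : Fin d → ℝ | 0 ≤ x j}) ∩ {x | ∑ j, x j ≤ 1} := by
      ext x; simp [Sd]
    rw [this]
    refine (isClosed_iInter fun j => isClosed_le continuous_const (continuous_apply j)).inter
      (isClosed_le (by fun_prop) continuous_const)
  · intro x hx
    exact ⟨hx.1, fun j => (Finset.single_le_sum (fun i _ => hx.1 i) (Finset.mem_univ j)).trans hx.2⟩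

theorem measurableSet_Sd (d : ℕ) : MeasurableSet (Sd d) := (isCompact_Sd d).measurableSet

theorem zero_mem_Sd (d : ℕ) : (0 : Fin d → ℝ) ∈ Sd d := by simp [Sd]

/-- The exponential `e^{-2πi ξ·x}`. -/
noncomputable def expDot (d : ℕ) (ξ x : Fin d → ℝ) : ℂ :=
  Complex.exp (-2 * π * Complex.I * (∑ i, ξ i * x i))

/-- The Fourier transform of `g χ_{S_d}`. -/
noncomputable def ftS (d : ℕ) (g : (Fin d → ℝ) → ℝ) (ξ : Fin d → ℝ) : ℂ :=
  ft d (fun x => (((Sd d).indicator g x : ℝ) : ℂ)) ξ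

theorem continuous_expDot (ξ : Fin d → ℝ) : Continuous (expDot d ξ) := by
  unfold expDot; fun_prop

theorem norm_expDot (ξ x : Fin d → ℝ) : ‖expDot d ξ x‖ = 1 := by
  have : -2 * π * Complex.I * ((∑ i, ξ i * x i : ℝ) : ℂ)
      = ((-2 * π * ∑ i, ξ i * x i : ℝ) : ℂ) * Complex.I := by
    push_cast; ring
  rw [expDot, this, Complex.norm_exp_ofReal_mul_I]

theorem ftS_eq_setIntegral (g : (Fin d → ℝ) → ℝ) (ξ : Fin d → ℝ) :
    ftS d g ξ = ∫ x in Sd d, (g x : ℂ) * expDot d ξ x := by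
  rw [← integral_indicator (measurableSet_Sd d)]
  refine integral_congr_ae (Filter.Eventually.of_forall fun x => ?_)
  by_cases hx : x ∈ Sd d <;> simp [hx, expDot]

/-- The first coordinates of a frequency. -/
def freqInit (d : ℕ) (ξ : Fin (d + 1) → ℝ) : Fin d → ℝ := fun i => ξ i.castSucc

/-- The frequency seen by the slanted face of the simplex. -/
def freqSlant (d : ℕ) (ξ : Fin (d + 1) → ℝ) : Fin d → ℝ := fun i => ξ i.castSucc - ξ (Fin.last d)

theorem expDot_snocCLM (ξ : Fin (d + 1) → ℝ) (x : Fin d → ℝ) (t : ℝ) :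
    expDot (d + 1) ξ (snocCLM d (x, t)) = expDot d (freqInit d ξ) x *
      Complex.exp (-(2 * π * Complex.I * ξ (Fin.last d)) * t) := by
  rw [expDot, expDot, ← Complex.exp_add, Fin.sum_univ_castSucc]
  simp only [snocCLM_castSucc, snocCLM_last, freqInit]
  congr 1
  push_cast
  ring

theorem expDot_freqSlant (ξ : Fin (d + 1) → ℝ) (x : Fin d → ℝ) :
    expDot d (freqInit d ξ) x *
      Complex.exp (-(2 * π * Complex.I * ξ (Fin.last d)) * ((1 - ∑ i, x i : ℝ) : ℂ))
    = Complex.exp (-(2 * π * Complex.I * ξ (Fin.last d))) * expDot d (freqSlant d ξ) x := by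
  simp only [expDot, ← Complex.exp_add, freqInit, freqSlant]
  congr 1
  push_cast
  simp only [sub_mul, Finset.sum_sub_distrib, ← Finset.mul_sum]
  ring

theorem snocCLM_mem_iff {x : Fin d → ℝ} {t : ℝ} :
    snocCLM d (x, t) ∈ Sd (d + 1) ↔ x ∈ Sd d ∧ t ∈ Set.Icc 0 (1 - ∑ i, x i) := by
  refine ⟨fun h => ?_, fun h => snocCLM_mem h.1 h.2.1 h.2.2⟩
  have h0 : ∀ i, 0 ≤ x i := fun i => by simpa using h.1 i.castSucc
  have ht : 0 ≤ t := by simpa using h.1 (Fin.last d)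
  have hs : ∑ i, x i + t ≤ 1 := by simpa [Fin.sum_univ_castSucc] using h.2
  exact ⟨⟨h0, by linarith⟩, ht, by linarith⟩

theorem setIntegral_Sd_succ {F : (Fin (d + 1) → ℝ) → ℂ} (hF : Continuous F) :
    ∫ y in Sd (d + 1), F y
      = ∫ x in Sd d, ∫ t in (0 : ℝ)..(1 - ∑ i, x i), F (snocCLM d (x, t)) := by
  have hmp := (volume_preserving_piFinSuccAbove (fun _ : Fin (d + 1) => ℝ) (Fin.last d)).symm
  have hsymm : ∀ p : ℝ × (Fin d → ℝ),
      (MeasurableEquiv.piFinSuccAbove (fun _ : Fin (d + 1) => ℝ) (Fin.last d)).symm p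
        = snocCLM d (p.2, p.1) := by
    intro p
    funext i
    refine Fin.lastCases ?_ (fun i => ?_) i
    · simp [MeasurableEquiv.piFinSuccAbove]
    · simp [MeasurableEquiv.piFinSuccAbove]
  have hintegrable : Integrable ((Sd (d + 1)).indicator F) :=
    (integrable_indicator_iff (measurableSet_Sd _)).2
      (hF.continuousOn.integrableOn_compact (isCompact_Sd _))
  rw [← integral_indicator (measurableSet_Sd _), ← integral_indicator (measurableSet_Sd _),
    ← hmp.integral_comp', Measure.volume_eq_prod, integral_prod_symm]
  · refine integral_congr_ae (Filter.Eventually.of_forall fun x => ?_)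
    by_cases hx : x ∈ Sd d
    · have h1 : 0 ≤ 1 - ∑ i, x i := by linarith [hx.2]
      simp only [Set.indicator_of_mem hx]
      rw [intervalIntegral.integral_of_le h1, ← integral_Icc_eq_integral_Ioc,
        ← integral_indicator measurableSet_Icc]
      refine integral_congr_ae (Filter.Eventually.of_forall fun t => ?_)
      beta_reduce
      by_cases ht : t ∈ Set.Icc 0 (1 - ∑ i, x i)
      · rw [hsymm, Set.indicator_of_mem ht,
          Set.indicator_of_mem (snocCLM_mem_iff.2 ⟨hx, ht⟩)]
      · rw [hsymm, Set.indicator_of_notMem ht,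
          Set.indicator_of_notMem fun h => ht (snocCLM_mem_iff.1 h).2]
    · simp [hsymm, snocCLM_mem_iff, hx]
  · exact hmp.integrable_comp_of_integrable hintegrable

theorem ftS_succ {g : (Fin (d + 1) → ℝ) → ℝ} (hg : Continuous g) (ξ : Fin (d + 1) → ℝ) :
    ftS (d + 1) g ξ = ∫ x in Sd d, expDot d (freqInit d ξ) x *
      ∫ t in (0 : ℝ)..(1 - ∑ i, x i), (g (snocCLM d (x, t)) : ℂ) *
        Complex.exp (-(2 * π * Complex.I * ξ (Fin.last d)) * t) := by
  rw [ftS_eq_setIntegral, setIntegral_Sd_succ]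
  · refine integral_congr_ae (Filter.Eventually.of_forall fun x => ?_)
    simp only [← intervalIntegral.integral_const_mul, expDot_snocCLM]
    congr 1
    funext t
    ring
  · exact (Complex.continuous_ofReal.comp hg).mul (continuous_expDot ξ)

theorem ftS_succ_of_last_eq_zero {g : (Fin (d + 1) → ℝ) → ℝ} (hg : Continuous g)
    {ξ : Fin (d + 1) → ℝ} (hξ : ξ (Fin.last d) = 0) :
    ftS (d + 1) g ξ = ftS d (fiberIntegral d g) (freqInit d ξ) := by
  rw [ftS_succ hg, ftS_eq_setIntegral]
  refine integral_congr_ae (Filter.Eventually.of_forall fun x => ?_)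
  simp only [hξ, fiberIntegral, Complex.ofReal_zero, mul_zero, neg_zero, zero_mul,
    Complex.exp_zero, mul_one, intervalIntegral.integral_ofReal]
  exact mul_comm _ _

theorem integral_mul_exp_neg {u u' : ℝ → ℝ} (hu : ∀ t, HasDerivAt u (u' t) t)
    (hu' : Continuous u') {c : ℂ} (hc : c ≠ 0) (a : ℝ) :
    ∫ t in (0 : ℝ)..a, (u t : ℂ) * Complex.exp (-c * t)
      = c⁻¹ * (u 0 - u a * Complex.exp (-c * a)
        + ∫ t in (0 : ℝ)..a, (u' t : ℂ) * Complex.exp (-c * t)) := by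
  have hv : ∀ t : ℝ, HasDerivAt (fun t : ℝ => -c⁻¹ * Complex.exp (-c * t))
      (Complex.exp (-c * t)) t := by
    intro t
    have h1 : HasDerivAt (fun t : ℝ => -c * (t : ℂ)) (-c * 1) t :=
      (Complex.ofRealCLM.hasDerivAt (x := t)).const_mul (-c)
    refine (h1.cexp.const_mul (-c⁻¹)).congr_deriv ?_
    field_simp
  rw [intervalIntegral.integral_mul_deriv_eq_deriv_mul (u' := fun t => (u' t : ℂ))
    (fun t _ => (hu t).ofReal_comp) (fun t _ => hv t)
    ((Complex.continuous_ofReal.comp hu').intervalIntegrable _ _)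
    (Continuous.intervalIntegrable (by fun_prop) _ _)]
  have : ∀ t : ℝ, (u' t : ℂ) * (-c⁻¹ * Complex.exp (-c * t))
      = -c⁻¹ * ((u' t : ℂ) * Complex.exp (-c * t)) := fun t => by ring
  simp only [this, intervalIntegral.integral_const_mul]
  simp
  ring

theorem ftS_integration_by_parts {g : (Fin (d + 1) → ℝ) → ℝ} (hg : ContDiff ℝ 1 g)
    {ξ : Fin (d + 1) → ℝ} (hξ : ξ (Fin.last d) ≠ 0) :
    ftS (d + 1) g ξ = (2 * π * Complex.I * ξ (Fin.last d))⁻¹ *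
      (ftS d (faceZero d g) (freqInit d ξ)
        - Complex.exp (-(2 * π * Complex.I * ξ (Fin.last d))) *
          ftS d (faceSum d g) (freqSlant d ξ)
        + ftS (d + 1) (pderivI (d + 1) (Fin.last d) g) ξ) := by
  have hg' : Continuous (pderivI (d + 1) (Fin.last d) g) :=
    (ContDiff.pderivI (n := 0) hg _).continuous
  have hc : (2 * π * Complex.I * ξ (Fin.last d) : ℂ) ≠ 0 := by
    simp [hξ, Real.pi_ne_zero]
  rw [ftS_succ hg.continuous, ftS_succ hg', ftS_eq_setIntegral, ftS_eq_setIntegral]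
  set c : ℂ := 2 * π * Complex.I * ξ (Fin.last d)
  have hintegrable : ∀ F : (Fin d → ℝ) → ℂ, Continuous F → IntegrableOn F (Sd d) := fun F hF =>
    hF.continuousOn.integrableOn_compact (isCompact_Sd d)
  have h0 : Continuous (fun x => (faceZero d g x : ℂ) * expDot d (freqInit d ξ) x) :=
    (Complex.continuous_ofReal.comp (contDiff_faceZero (n := 1) hg).continuous).mul
      (continuous_expDot _)
  have h1 : Continuous (fun x => (faceSum d g x : ℂ) * expDot d (freqSlant d ξ) x) :=
    (Complex.continuous_ofReal.comp (contDiff_faceSum (n := 1) hg).continuous).mul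
      (continuous_expDot _)
  have h2 : Continuous (fun x => expDot d (freqInit d ξ) x *
      ∫ t in (0 : ℝ)..(1 - ∑ i, x i),
        (pderivI (d + 1) (Fin.last d) g (snocCLM d (x, t)) : ℂ) * Complex.exp (-c * t)) := by
    refine (continuous_expDot _).mul
      (intervalIntegral.continuous_parametric_intervalIntegral_of_continuous
      (f := fun x t => (pderivI (d + 1) (Fin.last d) g (snocCLM d (x, t)) : ℂ) *
        Complex.exp (-c * t)) ?_ (by fun_prop))
    refine Continuous.mul ?_ ?_
    · exact Complex.continuous_ofReal.comp (hg'.comp (snocCLM d).continuous)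
    · exact Complex.continuous_exp.comp
        (continuous_const.mul (Complex.continuous_ofReal.comp continuous_snd))
  have h01 : Continuous (fun x => (faceZero d g x : ℂ) * expDot d (freqInit d ξ) x
      - Complex.exp (-c) * ((faceSum d g x : ℂ) * expDot d (freqSlant d ξ) x)) :=
    h0.sub (continuous_const.mul h1)
  rw [← integral_const_mul, ← integral_sub (hintegrable _ h0) ((hintegrable _ h1).const_mul _),
    ← integral_add (hintegrable _ h01) (hintegrable _ h2),
    ← integral_const_mul]
  refine integral_congr_ae (Filter.Eventually.of_forall fun x => ?_)
  have hder : ∀ t, HasDerivAt (fun t => g (snocCLM d (x, t)))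
      (pderivI (d + 1) (Fin.last d) g (snocCLM d (x, t))) t := by
    intro t
    have h := ((hg.differentiable (by simp) (snocCLM d (x, t))).hasFDerivAt.comp_hasDerivAt t
      ((snocCLM d).hasFDerivAt.comp_hasDerivAt t
        ((hasDerivAt_const t x).prodMk (hasDerivAt_id t))))
    rw [snocCLM_zero_one] at h
    exact h
  have hcont : Continuous fun t => pderivI (d + 1) (Fin.last d) g (snocCLM d (x, t)) :=
    hg'.comp ((snocCLM d).continuous.comp (Continuous.prodMk_right x))
  simp only
  rw [integral_mul_exp_neg hder hcont hc]
  have hE := expDot_freqSlant ξ x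
  change expDot d (freqInit d ξ) x * Complex.exp (-c * ((1 - ∑ i, x i : ℝ) : ℂ))
    = Complex.exp (-c) * expDot d (freqSlant d ξ) x at hE
  simp only [faceZero, faceSum]
  linear_combination (-c⁻¹ * g (snocCLM d (x, 1 - ∑ i, x i))) * hE

theorem ftS_expansion {w : ℕ} {g : (Fin (d + 1) → ℝ) → ℝ} (hg : ContDiff ℝ w g)
    {ξ : Fin (d + 1) → ℝ} (hξ : ξ (Fin.last d) ≠ 0) :
    ftS (d + 1) g ξ = (∑ j ∈ Finset.range w, ((2 * π * Complex.I * ξ (Fin.last d)) ^ (j + 1))⁻¹ *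
      (ftS d (faceZero d ((pderivI (d + 1) (Fin.last d))^[j] g)) (freqInit d ξ)
        - Complex.exp (-(2 * π * Complex.I * ξ (Fin.last d))) *
          ftS d (faceSum d ((pderivI (d + 1) (Fin.last d))^[j] g)) (freqSlant d ξ)))
      + ((2 * π * Complex.I * ξ (Fin.last d)) ^ w)⁻¹ *
        ftS (d + 1) ((pderivI (d + 1) (Fin.last d))^[w] g) ξ := by
  induction w with
  | zero => simp
  | succ w ih =>
    rw [ih (hg.of_le (by norm_cast; omega)), Finset.sum_range_succ,
      ftS_integration_by_parts (g := (pderivI (d + 1) (Fin.last d))^[w] g) _ hξ,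
      Function.iterate_succ_apply', pow_succ, mul_inv]
    · ring
    · exact ContDiff.pderivI_iterate (n := 1) (hg.of_le (by norm_cast; omega)) _

end FourierRecursion

section Combinatorics

variable {d : ℕ}

theorem sum_ite_isLeast (p : Fin d → Prop) [DecidablePred p]
    [∀ i, Decidable (p i ∧ ∀ m, p m → i ≤ m)] [Decidable (∃ m, p m)] :
    ∑ i, (if p i ∧ ∀ m, p m → i ≤ m then (1 : ℝ) else 0) = if ∃ m, p m then 1 else 0 := by
  by_cases h : ∃ m, p m
  · obtain ⟨i₀, hi₀, hmin⟩ := Finset.exists_min_image (Finset.univ.filter p) id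
      (by simpa [Finset.filter_nonempty_iff] using h)
    have hp : p i₀ := by simpa using hi₀
    have hle : ∀ m, p m → i₀ ≤ m := fun m hm => hmin m (by simpa using hm)
    have : ∀ i, (p i ∧ ∀ m, p m → i ≤ m) ↔ i = i₀ := fun i =>
      ⟨fun hi => le_antisymm (hi.2 _ hp) (hle _ hi.1), fun hi => hi ▸ ⟨hp, hle⟩⟩
    rw [if_pos h, Finset.sum_eq_single i₀ (fun i _ hi => if_neg fun hh => hi ((this i).1 hh))
      (by simp), if_pos ((this i₀).2 rfl)]
  · rw [if_neg h]
    exact Finset.sum_eq_zero fun i _ => if_neg fun hh => h ⟨i, hh.1⟩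

open Classical in
theorem sum_baseVec (v : Fin d → Bool) (k : Fin d) :
    ∑ i, baseVec d v k i = 1 - if ∃ m, k < m ∧ v m = true then 1 else 0 := by
  rw [← sum_ite_isLeast (fun m => k < m ∧ v m = true)]
  simp only [baseVec, Finset.sum_sub_distrib, Finset.sum_ite_eq', Finset.mem_univ, if_true]
  congr 1
  exact Finset.sum_congr rfl fun i _ => if_congr (by simp only [and_assoc, and_imp]) rfl rfl

theorem baseVec_snoc_castSucc (v : Fin d → Bool) (a : Bool) (k : Fin d) :
    baseVec (d + 1) (Fin.snoc (α := fun _ => Bool) v a) k.castSucc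
      = snocCLM d (baseVec d v k, if a = true then -∑ i, baseVec d v k i else 0) := by
  classical
  funext i
  refine Fin.lastCases ?_ (fun i => ?_) i
  · rw [snocCLM_last, sum_baseVec, baseVec, if_neg (Fin.castSucc_lt_last k).ne']
    simp only [Fin.castSucc_lt_last, true_and, Fin.snoc_last, Fin.forall_fin_succ',
      Fin.snoc_castSucc, Fin.castSucc_lt_castSucc_iff, le_refl, implies_true, and_true]
    have h1 : ∀ i : Fin d, ¬ Fin.last d ≤ i.castSucc := fun i =>
      not_le.2 (Fin.castSucc_lt_last i)
    simp only [h1, imp_false]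
    cases a
    · simp
    · by_cases h : ∃ m, k < m ∧ v m = true
      · rw [if_pos rfl, if_pos h, if_neg]
        · simp
        · rintro ⟨-, h'⟩
          obtain ⟨m, hm⟩ := h
          exact h' m hm.1 hm.2
      · rw [if_pos rfl, if_neg h, if_pos]
        · simp
        · exact ⟨rfl, fun m hm hv => h ⟨m, hm, hv⟩⟩
  · rw [snocCLM_castSucc]
    simp only [baseVec, Fin.castSucc_inj, Fin.castSucc_lt_castSucc_iff, Fin.snoc_castSucc,
      Fin.forall_fin_succ', Fin.castSucc_le_castSucc_iff]
    congr 1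
    refine if_congr ?_ rfl rfl
    simp [Fin.le_last]

theorem baseVec_last (v : Fin (d + 1) → Bool) :
    baseVec (d + 1) v (Fin.last d) = Pi.single (Fin.last d) 1 := by
  funext i
  rw [baseVec, if_neg (c := _ ∧ _) fun h => absurd h.1 (not_lt.2 (Fin.le_last i))]
  simp [Pi.single_apply]

theorem lamV_snoc (v : Fin d → Bool) (a : Bool) :
    lamV (d + 1) (Fin.snoc (α := fun _ => Bool) v a)
      = snocCLM d (lamV d v, if a = true then 1 - ∑ i, lamV d v i else 0) := by
  classical
  have hsum : ∑ i, lamV d v i = if ∃ m, v m = true then 1 else 0 := by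
    rw [← sum_ite_isLeast (fun m => v m = true)]
    exact Finset.sum_congr rfl fun i _ => if_congr Iff.rfl rfl rfl
  funext i
  refine Fin.lastCases ?_ (fun i => ?_) i
  · have h1 : ∀ i : Fin d, ¬ Fin.last d ≤ i.castSucc := fun i =>
      not_le.2 (Fin.castSucc_lt_last i)
    rw [snocCLM_last, hsum, lamV]
    simp only [Fin.snoc_last, Fin.forall_fin_succ', Fin.snoc_castSucc, le_refl, implies_true,
      and_true, h1, imp_false]
    cases a
    · simp
    · by_cases h : ∃ m, v m = true
      · rw [if_pos rfl, if_pos h, if_neg]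
        · simp
        · rintro ⟨-, h'⟩
          obtain ⟨m, hm⟩ := h
          exact h' m hm
      · rw [if_pos rfl, if_neg h, if_pos]
        · simp
        · exact ⟨rfl, fun m hv => h ⟨m, hv⟩⟩
  · rw [snocCLM_castSucc]
    simp only [lamV, Fin.snoc_castSucc, Fin.forall_fin_succ', Fin.castSucc_le_castSucc_iff]
    refine if_congr ?_ rfl rfl
    simp [Fin.le_last]

/-- The cone of frequencies orthogonal exactly to the basis vectors lying in a set `θ`. -/
def Qset (d : ℕ) (θ : Set (Fin d → ℝ)) : Set (Fin d → ℝ) :=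
  {ξ | ∀ b ∈ allBaseVecs d, ((∑ i, ξ i * b i) = 0 ↔ b ∈ θ)}

/-- The part of `θ` lying in the hyperplane `x_{d+1} = 0`. -/
def traceZero (d : ℕ) (θ : Set (Fin (d + 1) → ℝ)) : Set (Fin d → ℝ) :=
  {b | snocCLM d (b, 0) ∈ θ}

/-- The part of `θ` lying in the hyperplane `x_1 + ⋯ + x_{d+1} = 0`. -/
def traceSum (d : ℕ) (θ : Set (Fin (d + 1) → ℝ)) : Set (Fin d → ℝ) :=
  {b | snocCLM d (b, -∑ i, b i) ∈ θ}

theorem snocCLM_zero_mem_allBaseVecs {b : Fin d → ℝ} (hb : b ∈ allBaseVecs d) :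
    snocCLM d (b, 0) ∈ allBaseVecs (d + 1) := by
  obtain ⟨v, k, rfl⟩ := hb
  exact ⟨Fin.snoc (α := fun _ => Bool) v false, k.castSucc, by simp [baseVec_snoc_castSucc]⟩

theorem snocCLM_neg_sum_mem_allBaseVecs {b : Fin d → ℝ} (hb : b ∈ allBaseVecs d) :
    snocCLM d (b, -∑ i, b i) ∈ allBaseVecs (d + 1) := by
  obtain ⟨v, k, rfl⟩ := hb
  exact ⟨Fin.snoc (α := fun _ => Bool) v true, k.castSucc, by simp [baseVec_snoc_castSucc]⟩

theorem single_last_mem_allBaseVecs : Pi.single (Fin.last d) 1 ∈ allBaseVecs (d + 1) :=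
  ⟨fun _ => false, Fin.last d, (baseVec_last _).symm⟩

theorem dot_snocCLM_zero (ξ : Fin (d + 1) → ℝ) (b : Fin d → ℝ) :
    ∑ i, ξ i * snocCLM d (b, 0) i = ∑ i, freqInit d ξ i * b i := by
  simp [Fin.sum_univ_castSucc, freqInit]

theorem dot_snocCLM_neg_sum (ξ : Fin (d + 1) → ℝ) (b : Fin d → ℝ) :
    ∑ i, ξ i * snocCLM d (b, -∑ i, b i) i = ∑ i, freqSlant d ξ i * b i := by
  simp only [Fin.sum_univ_castSucc, freqSlant, snocCLM_castSucc, snocCLM_last, sub_mul,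
    Finset.sum_sub_distrib, ← Finset.mul_sum]
  ring

theorem freqInit_mem_Qset {θ : Set (Fin (d + 1) → ℝ)} {ξ : Fin (d + 1) → ℝ}
    (h : ξ ∈ Qset (d + 1) θ) : freqInit d ξ ∈ Qset d (traceZero d θ) := fun b hb => by
  rw [← dot_snocCLM_zero]
  exact h _ (snocCLM_zero_mem_allBaseVecs hb)

theorem freqSlant_mem_Qset {θ : Set (Fin (d + 1) → ℝ)} {ξ : Fin (d + 1) → ℝ}
    (h : ξ ∈ Qset (d + 1) θ) : freqSlant d ξ ∈ Qset d (traceSum d θ) := fun b hb => by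
  rw [← dot_snocCLM_neg_sum]
  exact h _ (snocCLM_neg_sum_mem_allBaseVecs hb)

theorem last_eq_zero_iff {θ : Set (Fin (d + 1) → ℝ)} {ξ : Fin (d + 1) → ℝ}
    (h : ξ ∈ Qset (d + 1) θ) : ξ (Fin.last d) = 0 ↔ Pi.single (Fin.last d) 1 ∈ θ := by
  rw [← h _ single_last_mem_allBaseVecs]
  simp [Pi.single_apply]

/-- Multi-indices of total degree at most `w`. -/
def Jset (d w : ℕ) : Finset (Fin d → ℕ) :=
  (Fintype.piFinset fun _ => Finset.range (w + 1)).filter fun J => ∑ k, J k ≤ w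

theorem mem_Jset {w : ℕ} {J : Fin d → ℕ} : J ∈ Jset d w ↔ ∑ k, J k ≤ w := by
  simp only [Jset, Finset.mem_filter, Fintype.mem_piFinset, Finset.mem_range, and_iff_right_iff_imp]
  exact fun h k => Nat.lt_succ_of_le
    ((Finset.single_le_sum (fun _ _ => Nat.zero_le _) (Finset.mem_univ k)).trans h)

theorem sum_Jset_succ {w : ℕ} (f : (Fin (d + 1) → ℕ) → ℂ) :
    ∑ J ∈ Jset (d + 1) w, f J = ∑ j ∈ Finset.range (w + 1), ∑ J ∈ Jset d (w - j),
      f (Fin.snoc (α := fun _ => ℕ) J j) := by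
  rw [Finset.sum_sigma']
  refine (Finset.sum_bij' (fun p _ => Fin.snoc (α := fun _ => ℕ) p.2 p.1)
    (fun J _ => ⟨J (Fin.last d), fun i => J i.castSucc⟩) ?_ ?_ ?_ ?_ ?_).symm
  · rintro ⟨j, J⟩ h
    simp only [Finset.mem_sigma, Finset.mem_range, mem_Jset] at h
    simp only [mem_Jset, Fin.sum_univ_castSucc, Fin.snoc_castSucc, Fin.snoc_last]
    omega
  · intro J h
    simp only [mem_Jset, Fin.sum_univ_castSucc] at h
    simp only [Finset.mem_sigma, Finset.mem_range, mem_Jset]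
    omega
  · rintro ⟨j, J⟩ _
    simp
  · intro J _
    exact Fin.snoc_init_self (α := fun _ => ℕ) J
  · intros; rfl

theorem sum_signs_succ (f : (Fin (d + 1) → Bool) → ℂ) :
    ∑ V, f V = ∑ V : Fin d → Bool, (f (Fin.snoc (α := fun _ => Bool) V false)
      + f (Fin.snoc (α := fun _ => Bool) V true)) := by
  rw [← (Fin.snocEquiv fun _ : Fin (d + 1) => Bool).sum_comp, Fintype.sum_prod_type_right]
  refine Finset.sum_congr rfl fun V _ => ?_
  rw [Fintype.sum_bool, add_comm]
  rfl

end Combinatorics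

section Expansion

variable {d : ℕ}

open Classical in
/-- The coefficient functionals of the expansion, on sufficiently smooth functions. -/
noncomputable def alphaF : (d : ℕ) → Set (Fin d → ℝ) → (Fin d → Bool) → (Fin d → ℕ) →
    ((Fin d → ℝ) → ℝ) → ℝ
  | 0, _, _, _, g => g 0
  | d + 1, θ, V, J, g =>
    if Pi.single (Fin.last d) 1 ∈ θ then
      if V (Fin.last d) = true then 0
      else alphaF d (traceZero d θ) (fun i => V i.castSucc) (fun i => J i.castSucc)
        (fiberIntegral d g)
    else if V (Fin.last d) = true then
      -alphaF d (traceSum d θ) (fun i => V i.castSucc) (fun i => J i.castSucc)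
        (faceSum d ((pderivI (d + 1) (Fin.last d))^[J (Fin.last d)] g))
    else alphaF d (traceZero d θ) (fun i => V i.castSucc) (fun i => J i.castSucc)
        (faceZero d ((pderivI (d + 1) (Fin.last d))^[J (Fin.last d)] g))

theorem fiberIntegral_add {f g : (Fin (d + 1) → ℝ) → ℝ} (hf : Continuous f) (hg : Continuous g) :
    fiberIntegral d (f + g) = fiberIntegral d f + fiberIntegral d g := by
  funext x
  have hc : ∀ f : (Fin (d + 1) → ℝ) → ℝ, Continuous f →
      Continuous fun t => f (snocCLM d (x, t)) := fun f hf =>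
    hf.comp ((snocCLM d).continuous.comp (Continuous.prodMk_right x))
  exact intervalIntegral.integral_add ((hc f hf).intervalIntegrable _ _)
    ((hc g hg).intervalIntegrable _ _)

theorem fiberIntegral_smul (c : ℝ) (f : (Fin (d + 1) → ℝ) → ℝ) :
    fiberIntegral d (c • f) = c • fiberIntegral d f := by
  funext x
  exact intervalIntegral.integral_const_mul _ _

theorem ContDiff.faces_pderivI_iterate {J : Fin (d + 1) → ℕ} {g : (Fin (d + 1) → ℝ) → ℝ}
    (hg : ContDiff ℝ (∑ k, J k : ℕ) g) :
    ContDiff ℝ (∑ k : Fin d, J k.castSucc : ℕ)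
      ((_root_.pderivI (d + 1) (Fin.last d))^[J (Fin.last d)] g) := by
  refine ContDiff.pderivI_iterate ?_ _
  rwa [← Fin.sum_univ_castSucc]

theorem alphaF_add (θ : Set (Fin d → ℝ)) (V : Fin d → Bool) (J : Fin d → ℕ)
    {f g : (Fin d → ℝ) → ℝ} (hf : ContDiff ℝ (∑ k, J k : ℕ) f)
    (hg : ContDiff ℝ (∑ k, J k : ℕ) g) :
    alphaF d θ V J (f + g) = alphaF d θ V J f + alphaF d θ V J g := by
  induction d with
  | zero => rfl
  | succ d ih =>
    have hle : ((∑ k : Fin d, J k.castSucc : ℕ) : WithTop ℕ∞) ≤ (∑ k, J k : ℕ) := by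
      rw [Fin.sum_univ_castSucc]; norm_cast; omega
    have hle' : ((J (Fin.last d) : ℕ) : WithTop ℕ∞) ≤ (∑ k, J k : ℕ) := by
      rw [Fin.sum_univ_castSucc]; norm_cast; omega
    simp only [alphaF]
    rw [pderivI_iterate_add (hf.of_le hle') (hg.of_le hle'),
      fiberIntegral_add hf.continuous hg.continuous]
    split_ifs
    · simp
    · exact ih _ _ _ (contDiff_fiberIntegral (hf.of_le hle))
        (contDiff_fiberIntegral (hg.of_le hle))
    · rw [← neg_add]
      exact congrArg Neg.neg (ih _ _ _ (contDiff_faceSum hf.faces_pderivI_iterate)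
        (contDiff_faceSum hg.faces_pderivI_iterate))
    · exact ih _ _ _ (contDiff_faceZero hf.faces_pderivI_iterate)
        (contDiff_faceZero hg.faces_pderivI_iterate)

theorem alphaF_smul (θ : Set (Fin d → ℝ)) (V : Fin d → Bool) (J : Fin d → ℕ) (c : ℝ)
    {f : (Fin d → ℝ) → ℝ} (hf : ContDiff ℝ (∑ k, J k : ℕ) f) :
    alphaF d θ V J (c • f) = c * alphaF d θ V J f := by
  induction d with
  | zero => rfl
  | succ d ih =>
    have hle : ((∑ k : Fin d, J k.castSucc : ℕ) : WithTop ℕ∞) ≤ (∑ k, J k : ℕ) := by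
      rw [Fin.sum_univ_castSucc]; norm_cast; omega
    have hle' : ((J (Fin.last d) : ℕ) : WithTop ℕ∞) ≤ (∑ k, J k : ℕ) := by
      rw [Fin.sum_univ_castSucc]; norm_cast; omega
    simp only [alphaF]
    rw [pderivI_iterate_smul c (hf.of_le hle'), fiberIntegral_smul]
    split_ifs
    · simp
    · exact ih _ _ _ (contDiff_fiberIntegral (hf.of_le hle))
    · rw [mul_neg]
      exact congrArg Neg.neg (ih _ _ _ (contDiff_faceSum hf.faces_pderivI_iterate))
    · exact ih _ _ _ (contDiff_faceZero hf.faces_pderivI_iterate)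

theorem pderivL_iterate (n : ℕ) (i : Fin d) (l : List (Fin d)) (g : (Fin d → ℝ) → ℝ) :
    pderivL d l ((pderivI d i)^[n] g) = pderivL d (List.replicate n i ++ l) g := by
  rw [pderivL_append, pderivL_replicate]

theorem abs_alphaF_le (θ : Set (Fin d → ℝ)) (V : Fin d → Bool) (J : Fin d → ℕ)
    {g : (Fin d → ℝ) → ℝ} (hg : ContDiff ℝ (∑ k, J k : ℕ) g) {M : ℝ}
    (hM : ∀ l : List (Fin d), l.length ≤ ∑ k, J k → ∀ x ∈ Sd d, |pderivL d l g x| ≤ M) :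
    |alphaF d θ V J g| ≤ (2 ^ (d - 1)) ^ (∑ k, J k) * M := by
  induction d generalizing M with
  | zero => simpa [alphaF, pderivL] using hM [] (Nat.zero_le _) 0 (zero_mem_Sd 0)
  | succ d ih =>
    have hM0 : 0 ≤ M := (abs_nonneg _).trans (hM [] (Nat.zero_le _) 0 (zero_mem_Sd _))
    have hs1 := one_le_slantFactor d
    have hsum : ∑ k, J k = ∑ k : Fin d, J k.castSucc + J (Fin.last d) := Fin.sum_univ_castSucc J
    set s := ∑ k : Fin d, J k.castSucc
    have hle : ((s : ℕ) : WithTop ℕ∞) ≤ (∑ k, J k : ℕ) := by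
      rw [hsum]; norm_cast; omega
    have hfin : (2 ^ (d - 1)) ^ s * (slantFactor d ^ s * M)
        ≤ (2 ^ (d + 1 - 1)) ^ (∑ k, J k) * M := by
      rw [← mul_assoc, ← mul_pow, pow_mul_slantFactor]
      gcongr
      · exact one_le_pow₀ (by norm_num)
      · exact hsum ▸ Nat.le_add_right _ _
    have hpow : ∀ n ≤ s, slantFactor d ^ n * M ≤ slantFactor d ^ s * M := fun n hn => by
      gcongr
    have hgs := hg.faces_pderivI_iterate
    have hMj : ∀ l : List (Fin (d + 1)), l.length ≤ s → ∀ x ∈ Sd (d + 1),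
        |pderivL (d + 1) l ((pderivI (d + 1) (Fin.last d))^[J (Fin.last d)] g) x| ≤ M := by
      intro l hl x hx
      rw [pderivL_iterate]
      exact hM _ (by simp; omega) x hx
    simp only [alphaF]
    split_ifs
    · simpa using by positivity
    · refine (ih _ _ _ (contDiff_fiberIntegral (hg.of_le hle)) fun l hl x hx => ?_).trans hfin
      refine (abs_pderivL_fiberIntegral_le l (hg.of_le (hle.trans' (by exact_mod_cast hl)))
        (fun l' hl' _ x hx => hM l' (by omega) x hx) hx).trans (hpow _ hl)
    · rw [abs_neg]
      refine (ih _ _ _ (contDiff_faceSum hgs) fun l hl x hx => ?_).trans hfin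
      exact (abs_pderivL_faceSum_le l (hgs.of_le (by exact_mod_cast hl))
        (fun l' hl' x hx => hMj l' (hl'.trans_le hl) x hx) hx).trans (hpow _ hl)
    · refine (ih _ _ _ (contDiff_faceZero hgs) fun l hl x hx => ?_).trans hfin
      rw [pderivL_faceZero l (hgs.of_le (by exact_mod_cast hl))]
      refine (hMj _ (by simpa using hl) _ (snocCLM_faceZero_mem hx)).trans ?_
      exact le_mul_of_one_le_left hM0 (one_le_pow₀ hs1)

open Classical in
/-- The oscillating factor multiplying `alphaF` in the expansion. -/
noncomputable def phase (d : ℕ) (θ : Set (Fin d → ℝ)) (V : Fin d → Bool) (J : Fin d → ℕ)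
    (ξ : Fin d → ℝ) : ℂ :=
  if ∀ k, baseVec d V k ∈ θ → J k = 0 then
    Complex.exp (-2 * π * Complex.I * (∑ i, lamV d V i * ξ i : ℝ)) /
      ∏ k, (if baseVec d V k ∈ θ then 1 else
        (2 * π * Complex.I * ((∑ i, baseVec d V k i * ξ i : ℝ) : ℂ)) ^ (J k + 1))
  else 0

theorem dot_single_last (ξ : Fin (d + 1) → ℝ) :
    ∑ i, (Pi.single (Fin.last d) 1 : Fin (d + 1) → ℝ) i * ξ i = ξ (Fin.last d) := by
  simp [Pi.single_apply]

theorem phase_snoc {θ : Set (Fin (d + 1) → ℝ)} {θ' : Set (Fin d → ℝ)}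
    (hθ : Pi.single (Fin.last d) 1 ∉ θ) (V : Fin d → Bool) (a : Bool) (J : Fin d → ℕ) (j : ℕ)
    {ξ : Fin (d + 1) → ℝ} {ξ' : Fin d → ℝ} {s : ℝ}
    (hmem : ∀ k : Fin d, baseVec (d + 1) (Fin.snoc (α := fun _ => Bool) V a) k.castSucc ∈ θ ↔
      baseVec d V k ∈ θ')
    (hdot : ∀ k : Fin d, ∑ i, baseVec (d + 1) (Fin.snoc (α := fun _ => Bool) V a) k.castSucc i * ξ i
      = ∑ i, baseVec d V k i * ξ' i)
    (hlam : ∑ i, lamV (d + 1) (Fin.snoc (α := fun _ => Bool) V a) i * ξ i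
      = s + ∑ i, lamV d V i * ξ' i) :
    phase (d + 1) θ (Fin.snoc (α := fun _ => Bool) V a) (Fin.snoc (α := fun _ => ℕ) J j) ξ
      = ((2 * π * Complex.I * ξ (Fin.last d)) ^ (j + 1))⁻¹ *
        (Complex.exp (-2 * π * Complex.I * s) * phase d θ' V J ξ') := by
  have hcond : (∀ k, baseVec (d + 1) (Fin.snoc (α := fun _ => Bool) V a) k ∈ θ →
      Fin.snoc (α := fun _ => ℕ) J j k = 0) ↔ ∀ k, baseVec d V k ∈ θ' → J k = 0 := by
    simp only [Fin.forall_fin_succ', hmem, baseVec_last, hθ, Fin.snoc_castSucc, false_imp_iff,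
      and_true]
  classical
  have hprod : ∏ k : Fin d, (if baseVec (d + 1) (Fin.snoc (α := fun _ => Bool) V a) k.castSucc ∈ θ
      then (1 : ℂ) else (2 * π * Complex.I * ((∑ i, baseVec (d + 1)
        (Fin.snoc (α := fun _ => Bool) V a) k.castSucc i * ξ i : ℝ) : ℂ)) ^
          (Fin.snoc (α := fun _ => ℕ) J j k.castSucc + 1))
      = ∏ k, (if baseVec d V k ∈ θ' then (1 : ℂ) else
        (2 * π * Complex.I * ((∑ i, baseVec d V k i * ξ' i : ℝ) : ℂ)) ^ (J k + 1)) :=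
    Finset.prod_congr rfl fun k _ => if_congr (hmem k) rfl (by rw [hdot k, Fin.snoc_castSucc])
  simp only [phase]
  by_cases hc : ∀ k, baseVec d V k ∈ θ' → J k = 0
  · rw [if_pos hc, if_pos (hcond.2 hc), Fin.prod_univ_castSucc, hlam, baseVec_last, if_neg hθ,
      dot_single_last, Fin.snoc_last, Complex.ofReal_add, mul_add, Complex.exp_add,
      hprod, mul_div_assoc', div_eq_mul_inv, mul_inv, div_eq_mul_inv]
    ring
  · rw [if_neg hc, if_neg fun h => hc (hcond.1 h)]
    simp

theorem phase_snoc_false {θ : Set (Fin (d + 1) → ℝ)} (hθ : Pi.single (Fin.last d) 1 ∉ θ)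
    (V : Fin d → Bool) (J : Fin d → ℕ) (j : ℕ) (ξ : Fin (d + 1) → ℝ) :
    phase (d + 1) θ (Fin.snoc (α := fun _ => Bool) V false) (Fin.snoc (α := fun _ => ℕ) J j) ξ
      = ((2 * π * Complex.I * ξ (Fin.last d)) ^ (j + 1))⁻¹ *
        phase d (traceZero d θ) V J (freqInit d ξ) := by
  have h (b : Fin d → ℝ) : ∑ i, snocCLM d (b, 0) i * ξ i = ∑ i, b i * freqInit d ξ i := by
    simpa only [mul_comm] using dot_snocCLM_zero ξ b
  rw [phase_snoc (θ' := traceZero d θ) (ξ' := freqInit d ξ) (s := 0) hθ]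
  · simp
  · intro k
    simp [baseVec_snoc_castSucc, traceZero]
  · intro k
    simp [baseVec_snoc_castSucc, h]
  · simp [lamV_snoc, h]

theorem phase_snoc_true {θ : Set (Fin (d + 1) → ℝ)} (hθ : Pi.single (Fin.last d) 1 ∉ θ)
    (V : Fin d → Bool) (J : Fin d → ℕ) (j : ℕ) (ξ : Fin (d + 1) → ℝ) :
    phase (d + 1) θ (Fin.snoc (α := fun _ => Bool) V true) (Fin.snoc (α := fun _ => ℕ) J j) ξ
      = ((2 * π * Complex.I * ξ (Fin.last d)) ^ (j + 1))⁻¹ *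
        (Complex.exp (-(2 * π * Complex.I * ξ (Fin.last d))) *
          phase d (traceSum d θ) V J (freqSlant d ξ)) := by
  have h (b : Fin d → ℝ) : ∑ i, snocCLM d (b, -∑ i, b i) i * ξ i
      = ∑ i, b i * freqSlant d ξ i := by
    simpa only [mul_comm] using dot_snocCLM_neg_sum ξ b
  rw [phase_snoc (θ' := traceSum d θ) (ξ' := freqSlant d ξ) (s := ξ (Fin.last d)) hθ]
  · rw [show -(2 * π * Complex.I * ξ (Fin.last d)) = -2 * π * Complex.I * ξ (Fin.last d) by ring]
  · intro k
    simp [baseVec_snoc_castSucc, traceSum]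
  · intro k
    rw [baseVec_snoc_castSucc, if_pos rfl, h]
  · simp only [lamV_snoc, if_true, Fin.sum_univ_castSucc, freqSlant, snocCLM_castSucc,
      snocCLM_last, mul_sub, Finset.sum_sub_distrib, ← Finset.sum_mul]
    ring

theorem phase_snoc_false_of_mem {θ : Set (Fin (d + 1) → ℝ)} (hθ : Pi.single (Fin.last d) 1 ∈ θ)
    (V : Fin d → Bool) (J : Fin d → ℕ) (j : ℕ) (ξ : Fin (d + 1) → ℝ) :
    phase (d + 1) θ (Fin.snoc (α := fun _ => Bool) V false) (Fin.snoc (α := fun _ => ℕ) J j) ξ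
      = if j = 0 then phase d (traceZero d θ) V J (freqInit d ξ) else 0 := by
  have h (b : Fin d → ℝ) : ∑ i, snocCLM d (b, 0) i * ξ i = ∑ i, b i * freqInit d ξ i := by
    simpa only [mul_comm] using dot_snocCLM_zero ξ b
  have hmem (k : Fin d) : baseVec (d + 1) (Fin.snoc (α := fun _ => Bool) V false) k.castSucc ∈ θ ↔
      baseVec d V k ∈ traceZero d θ := by
    simp [baseVec_snoc_castSucc, traceZero]
  have hcond : (∀ k, baseVec (d + 1) (Fin.snoc (α := fun _ => Bool) V false) k ∈ θ →
      Fin.snoc (α := fun _ => ℕ) J j k = 0) ↔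
        (∀ k, baseVec d V k ∈ traceZero d θ → J k = 0) ∧ j = 0 := by
    simp only [Fin.forall_fin_succ', hmem, baseVec_last, hθ, Fin.snoc_castSucc, Fin.snoc_last,
      true_imp_iff]
  have hlam : ∑ i, lamV (d + 1) (Fin.snoc (α := fun _ => Bool) V false) i * ξ i
      = ∑ i, lamV d V i * freqInit d ξ i := by
    simp [lamV_snoc, h]
  classical
  by_cases hj : j = 0
  · rw [if_pos hj]
    refine if_congr (hcond.trans (and_iff_left hj)) ?_ rfl
    rw [Fin.prod_univ_castSucc, hlam, baseVec_last, if_pos hθ, mul_one]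
    refine congrArg _ (Finset.prod_congr rfl fun k _ => if_congr (hmem k) rfl ?_)
    rw [baseVec_snoc_castSucc, if_neg Bool.false_ne_true, h, Fin.snoc_castSucc]
  · rw [if_neg hj, phase, if_neg fun hc => hj (hcond.1 hc).2]

/-- The main term of the expansion. -/
noncomputable def mainSum (d : ℕ) (θ : Set (Fin d → ℝ)) (w : ℕ) (g : (Fin d → ℝ) → ℝ)
    (ξ : Fin d → ℝ) : ℂ :=
  ∑ V : Fin d → Bool, ∑ J ∈ Jset d w, (alphaF d θ V J g : ℂ) * phase d θ V J ξ

theorem mainSum_succ_of_notMem {θ : Set (Fin (d + 1) → ℝ)} (hθ : Pi.single (Fin.last d) 1 ∉ θ)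
    (w : ℕ) (g : (Fin (d + 1) → ℝ) → ℝ) (ξ : Fin (d + 1) → ℝ) :
    mainSum (d + 1) θ w g ξ = ∑ j ∈ Finset.range (w + 1),
      ((2 * π * Complex.I * ξ (Fin.last d)) ^ (j + 1))⁻¹ *
        (mainSum d (traceZero d θ) (w - j)
            (faceZero d ((pderivI (d + 1) (Fin.last d))^[j] g)) (freqInit d ξ)
          - Complex.exp (-(2 * π * Complex.I * ξ (Fin.last d))) *
            mainSum d (traceSum d θ) (w - j)
              (faceSum d ((pderivI (d + 1) (Fin.last d))^[j] g)) (freqSlant d ξ)) := by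
  simp only [mainSum, sum_signs_succ, sum_Jset_succ, alphaF, hθ, if_false, if_true, Fin.snoc_last,
    Fin.snoc_castSucc, Bool.false_eq_true, phase_snoc_false hθ, phase_snoc_true hθ]
  rw [Finset.sum_add_distrib, Finset.sum_comm, Finset.sum_comm (s := Finset.univ),
    ← Finset.sum_add_distrib]
  refine Finset.sum_congr rfl fun j _ => ?_
  rw [Finset.mul_sum, mul_sub, Finset.mul_sum, Finset.mul_sum, sub_eq_add_neg,
    ← Finset.sum_neg_distrib]
  congr 1 <;> refine Finset.sum_congr rfl fun V _ => ?_
  · rw [Finset.mul_sum]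
    exact Finset.sum_congr rfl fun J _ => by ring
  · rw [Finset.mul_sum, Finset.mul_sum, ← Finset.sum_neg_distrib]
    exact Finset.sum_congr rfl fun J _ => by push_cast; ring

theorem mainSum_succ_of_mem {θ : Set (Fin (d + 1) → ℝ)} (hθ : Pi.single (Fin.last d) 1 ∈ θ)
    (w : ℕ) (g : (Fin (d + 1) → ℝ) → ℝ) (ξ : Fin (d + 1) → ℝ) :
    mainSum (d + 1) θ w g ξ
      = mainSum d (traceZero d θ) w (fiberIntegral d g) (freqInit d ξ) := by
  simp only [mainSum, sum_signs_succ, sum_Jset_succ, alphaF, hθ, if_true, Fin.snoc_last,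
    Fin.snoc_castSucc, Bool.false_eq_true, if_false, phase_snoc_false_of_mem hθ,
    Complex.ofReal_zero, zero_mul, Finset.sum_const_zero, add_zero]
  refine Finset.sum_congr rfl fun V _ => ?_
  rw [Finset.sum_eq_single 0]
  · simp
  · intro j _ hj
    simp [hj]
  · simp

/-- The remainder of the expansion. -/
noncomputable def rem (d : ℕ) (θ : Set (Fin d → ℝ)) (w : ℕ) (g : (Fin d → ℝ) → ℝ)
    (ξ : Fin d → ℝ) : ℂ :=
  ftS d g ξ - mainSum d θ w g ξ

theorem rem_zero (θ : Set (Fin 0 → ℝ)) (w : ℕ) (g : (Fin 0 → ℝ) → ℝ) (ξ : Fin 0 → ℝ) :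
    rem 0 θ w g ξ = 0 := by
  have h : Jset 0 w = {0} := by
    ext J
    simp [mem_Jset, Subsingleton.elim J 0]
  have hS : Sd 0 = Set.univ := by
    ext x
    simp [Sd]
  rw [rem, ftS_eq_setIntegral, mainSum, h, hS]
  have hvol : (volume : Measure (Fin 0 → ℝ)) = Measure.dirac 0 := by
    rw [volume_pi, Measure.pi_of_empty _ 0]
  simp [phase, alphaF, expDot, hvol]

theorem rem_succ_of_notMem {θ : Set (Fin (d + 1) → ℝ)} (hθ : Pi.single (Fin.last d) 1 ∉ θ)
    {w : ℕ} {g : (Fin (d + 1) → ℝ) → ℝ} (hg : ContDiff ℝ (w + 1 : ℕ) g)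
    {ξ : Fin (d + 1) → ℝ} (hξ : ξ (Fin.last d) ≠ 0) :
    rem (d + 1) θ w g ξ = (∑ j ∈ Finset.range (w + 1),
      ((2 * π * Complex.I * ξ (Fin.last d)) ^ (j + 1))⁻¹ *
        (rem d (traceZero d θ) (w - j)
            (faceZero d ((pderivI (d + 1) (Fin.last d))^[j] g)) (freqInit d ξ)
          - Complex.exp (-(2 * π * Complex.I * ξ (Fin.last d))) *
            rem d (traceSum d θ) (w - j)
              (faceSum d ((pderivI (d + 1) (Fin.last d))^[j] g)) (freqSlant d ξ)))
      + ((2 * π * Complex.I * ξ (Fin.last d)) ^ (w + 1))⁻¹ *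
        ftS (d + 1) ((pderivI (d + 1) (Fin.last d))^[w + 1] g) ξ := by
  rw [rem, mainSum_succ_of_notMem hθ, ftS_expansion hg hξ, add_sub_right_comm,
    ← Finset.sum_sub_distrib]
  congr 1
  refine Finset.sum_congr rfl fun j _ => ?_
  simp only [rem]
  ring

theorem rem_succ_of_mem {θ : Set (Fin (d + 1) → ℝ)} (hθ : Pi.single (Fin.last d) 1 ∈ θ)
    {w : ℕ} {g : (Fin (d + 1) → ℝ) → ℝ} (hg : Continuous g)
    {ξ : Fin (d + 1) → ℝ} (hξ : ξ (Fin.last d) = 0) :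
    rem (d + 1) θ w g ξ = rem d (traceZero d θ) w (fiberIntegral d g) (freqInit d ξ) := by
  rw [rem, mainSum_succ_of_mem hθ, ftS_succ_of_last_eq_zero hg hξ, rem]

end Expansion

section Torus

variable {d : ℕ}

instance : IsProbabilityMeasure (volume : Measure UnitAddCircle) :=
  ⟨by simp [AddCircle.measure_univ]⟩

/-- `a` is the sequence of Fourier coefficients of a measurable function on the circle that is
bounded by `A`. -/
def IsCircleCoeff (a : ℤ → ℂ) (A : ℝ) : Prop :=
  ∃ k : UnitAddCircle → ℂ, Measurable k ∧ (∀ t, ‖k t‖ ≤ A) ∧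
    ∀ m, ∫ t, fourier (-m) t * k t = a m

/-- `a` is the sequence of Fourier coefficients of a measurable function on the torus that is
bounded by `A`. -/
def IsTorusCoeff (d : ℕ) (a : (Fin d → ℤ) → ℂ) (A : ℝ) : Prop :=
  ∃ F : UnitAddTorus (Fin d) → ℂ, Measurable F ∧ (∀ x, ‖F x‖ ≤ A) ∧
    ∀ n, ∫ x, UnitAddTorus.mFourier (-n) x * F x = a n

theorem norm_mFourier_apply (n : Fin d → ℤ) (x : UnitAddTorus (Fin d)) :
    ‖UnitAddTorus.mFourier n x‖ = 1 := by
  simp only [UnitAddTorus.mFourier, ContinuousMap.coe_mk, norm_prod]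
  exact Finset.prod_eq_one fun i _ => Circle.norm_coe _

theorem fourier_add_apply (m : ℤ) (s t : UnitAddCircle) :
    fourier m (s + t) = fourier m s * fourier m t := by
  simp [fourier_apply, smul_add, AddCircle.toCircle_add]

theorem fourier_zsmul_apply (m b : ℤ) (t : UnitAddCircle) :
    fourier m (b • t) = fourier (m * b) t := by
  simp [fourier_apply, smul_smul]

theorem mFourier_add_apply (n : Fin d → ℤ) (x y : UnitAddTorus (Fin d)) :
    UnitAddTorus.mFourier n (x + y) = UnitAddTorus.mFourier n x * UnitAddTorus.mFourier n y := by
  simp only [UnitAddTorus.mFourier, ContinuousMap.coe_mk, Pi.add_apply, fourier_add_apply,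
    Finset.prod_mul_distrib]

theorem fourier_sum_index (n : Fin d → ℤ) (t : UnitAddCircle) :
    ∏ i, fourier (n i) t = (fourier (∑ i, n i) t : ℂ) := by
  have h : ∀ s : Finset (Fin d), ∏ i ∈ s, (fourier (n i) t : ℂ) = fourier (∑ i ∈ s, n i) t := by
    intro s
    induction s using Finset.induction_on with
    | empty => simp
    | insert i s hi ih => rw [Finset.prod_insert hi, Finset.sum_insert hi, fourier_add, ih]
  exact h _

theorem fourier_sum_apply (m : ℤ) (x : UnitAddTorus (Fin d)) :
    (fourier m (∑ i, x i) : ℂ) = ∏ i, fourier m (x i) := by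
  have h : ∀ s : Finset (Fin d), (fourier m (∑ i ∈ s, x i) : ℂ) = ∏ i ∈ s, fourier m (x i) := by
    intro s
    induction s using Finset.induction_on with
    | empty => simp
    | insert i s hi ih => rw [Finset.prod_insert hi, Finset.sum_insert hi, fourier_add_apply, ih]
  exact h _

theorem mFourier_smul_apply (n b : Fin d → ℤ) (t : UnitAddCircle) :
    UnitAddTorus.mFourier n (fun i => b i • t) = fourier (∑ i, n i * b i) t := by
  simp only [UnitAddTorus.mFourier, ContinuousMap.coe_mk, fourier_zsmul_apply]
  exact fourier_sum_index _ _

theorem integrable_of_bound {X : Type*} [MeasurableSpace X] {μ : Measure X} [IsFiniteMeasure μ]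
    {F : X → ℂ} (hF : Measurable F) {A : ℝ} (hA : ∀ x, ‖F x‖ ≤ A) : Integrable F μ :=
  Integrable.of_bound hF.aestronglyMeasurable A (Filter.Eventually.of_forall hA)

theorem measurable_mFourier_mul (n : Fin d → ℤ) {F : UnitAddTorus (Fin d) → ℂ} (hF : Measurable F) :
    Measurable fun x => UnitAddTorus.mFourier n x * F x :=
  (UnitAddTorus.mFourier n).continuous.measurable.mul hF

theorem norm_mFourier_mul_le (n : Fin d → ℤ) {F : UnitAddTorus (Fin d) → ℂ} {A : ℝ}
    (hA : ∀ x, ‖F x‖ ≤ A) (x : UnitAddTorus (Fin d)) :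
    ‖UnitAddTorus.mFourier n x * F x‖ ≤ A := by
  rw [norm_mul, norm_mFourier_apply, one_mul]
  exact hA x

theorem integrable_mFourier_mul (n : Fin d → ℤ) {F : UnitAddTorus (Fin d) → ℂ} (hF : Measurable F)
    {A : ℝ} (hA : ∀ x, ‖F x‖ ≤ A) : Integrable fun x => UnitAddTorus.mFourier n x * F x :=
  integrable_of_bound (measurable_mFourier_mul n hF) (norm_mFourier_mul_le n hA)

theorem IsTorusCoeff.zero : IsTorusCoeff d (fun _ => 0) 0 :=
  ⟨0, measurable_zero, by simp, by simp⟩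

theorem IsTorusCoeff.mono {a : (Fin d → ℤ) → ℂ} {A B : ℝ} (h : IsTorusCoeff d a A) (hAB : A ≤ B) :
    IsTorusCoeff d a B := by
  obtain ⟨F, hF, hA, hc⟩ := h
  exact ⟨F, hF, fun x => (hA x).trans hAB, hc⟩

theorem IsTorusCoeff.congr {a b : (Fin d → ℤ) → ℂ} {A : ℝ} (h : IsTorusCoeff d a A)
    (hab : ∀ n, a n = b n) : IsTorusCoeff d b A := by
  rwa [← funext hab]

theorem IsTorusCoeff.nonneg {a : (Fin d → ℤ) → ℂ} {A : ℝ} (h : IsTorusCoeff d a A) : 0 ≤ A := by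
  obtain ⟨F, -, hA, -⟩ := h
  exact (norm_nonneg _).trans (hA 0)

theorem IsTorusCoeff.add {a b : (Fin d → ℤ) → ℂ} {A B : ℝ} (ha : IsTorusCoeff d a A)
    (hb : IsTorusCoeff d b B) : IsTorusCoeff d (fun n => a n + b n) (A + B) := by
  obtain ⟨F, hF, hA, hc⟩ := ha
  obtain ⟨G, hG, hB, hc'⟩ := hb
  refine ⟨fun x => F x + G x, hF.add hG, fun x => (norm_add_le _ _).trans
    (add_le_add (hA x) (hB x)), fun n => ?_⟩
  simp only [mul_add]
  rw [integral_add (integrable_mFourier_mul _ hF hA) (integrable_mFourier_mul _ hG hB), hc, hc']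

theorem IsTorusCoeff.sub {a b : (Fin d → ℤ) → ℂ} {A B : ℝ} (ha : IsTorusCoeff d a A)
    (hb : IsTorusCoeff d b B) : IsTorusCoeff d (fun n => a n - b n) (A + B) := by
  obtain ⟨F, hF, hA, hc⟩ := ha
  obtain ⟨G, hG, hB, hc'⟩ := hb
  refine ⟨fun x => F x - G x, hF.sub hG, fun x => (norm_sub_le _ _).trans
    (add_le_add (hA x) (hB x)), fun n => ?_⟩
  simp only [mul_sub]
  rw [integral_sub (integrable_mFourier_mul _ hF hA) (integrable_mFourier_mul _ hG hB), hc, hc']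

theorem IsTorusCoeff.const_mul {a : (Fin d → ℤ) → ℂ} {A : ℝ} (ha : IsTorusCoeff d a A) (c : ℂ) :
    IsTorusCoeff d (fun n => c * a n) (‖c‖ * A) := by
  obtain ⟨F, hF, hA, hc⟩ := ha
  refine ⟨fun x => c * F x, hF.const_mul c, fun x => ?_, fun n => ?_⟩
  · rw [norm_mul]
    exact mul_le_mul_of_nonneg_left (hA x) (norm_nonneg _)
  · simp only [mul_left_comm _ c]
    rw [integral_const_mul, hc]

theorem IsTorusCoeff.sum {ι : Type*} (s : Finset ι) {a : ι → (Fin d → ℤ) → ℂ} {A : ι → ℝ}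
    (h : ∀ i ∈ s, IsTorusCoeff d (a i) (A i)) :
    IsTorusCoeff d (fun n => ∑ i ∈ s, a i n) (∑ i ∈ s, A i) := by
  classical
  induction s using Finset.induction_on with
  | empty => simpa using IsTorusCoeff.zero
  | insert i s hi ih =>
    simp only [Finset.sum_insert hi]
    exact (h i (Finset.mem_insert_self i s)).add
      (ih fun j hj => h j (Finset.mem_insert_of_mem hj))

theorem IsCircleCoeff.translate {a : ℤ → ℂ} {A : ℝ} (h : IsCircleCoeff a A) (s : ℝ) :
    IsCircleCoeff (fun m => Complex.exp (-2 * π * Complex.I * (m * s)) * a m) A := by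
  obtain ⟨k, hk, hA, hc⟩ := h
  refine ⟨fun t => k (t - (s : UnitAddCircle)), hk.comp (measurable_sub_const _),
    fun t => hA _, fun m => ?_⟩
  beta_reduce
  rw [← integral_add_right_eq_self _ (s : UnitAddCircle), ← hc, ← integral_const_mul]
  refine integral_congr_ae (Filter.Eventually.of_forall fun t => ?_)
  simp only [fourier_add_apply, add_sub_cancel_right]
  rw [fourier_coe_apply, mul_assoc, mul_left_comm, mul_assoc]
  congr 2
  push_cast
  ring_nf

theorem integral_fourier_mul (k : UnitAddCircle → ℂ) (m : ℤ) :
    ∫ t, fourier (-m) t * k t = fourierCoeff k m := by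
  rw [fourierCoeff, AddCircle.volume_eq_smul_haarAddCircle]
  simp [smul_eq_mul]

theorem isCircleCoeff_one : IsCircleCoeff (fun m => if m = 0 then 1 else 0) 1 := by
  refine ⟨fourier 0, (fourier 0).continuous.measurable, by simp, fun m => ?_⟩
  rw [integral_fourier_mul, fourierCoeff_fourier, Pi.single_apply]

theorem IsTorusCoeff.convolve {a : (Fin d → ℤ) → ℂ} {k : ℤ → ℂ} {A K : ℝ}
    (ha : IsTorusCoeff d a A) (hk : IsCircleCoeff k K) (b : Fin d → ℤ) :
    IsTorusCoeff d (fun n => k (∑ i, n i * b i) * a n) (K * A) := by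
  have hA0 := ha.nonneg
  obtain ⟨F, hF, hA, hc⟩ := ha
  obtain ⟨f, hf, hK, hc'⟩ := hk
  have hm : Measurable fun p : UnitAddTorus (Fin d) × UnitAddCircle =>
      f p.2 * F (p.1 - fun i => b i • p.2) := by
    refine (hf.comp measurable_snd).mul (hF.comp (measurable_fst.sub ?_))
    exact measurable_pi_lambda _ fun i =>
      ((continuous_zsmul (b i)).measurable).comp measurable_snd
  have hb : ∀ p : UnitAddTorus (Fin d) × UnitAddCircle,
      ‖f p.2 * F (p.1 - fun i => b i • p.2)‖ ≤ K * A := fun p => by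
    rw [norm_mul]
    exact mul_le_mul (hK _) (hA _) (norm_nonneg _) ((norm_nonneg _).trans (hK 0))
  refine ⟨fun x => ∫ t, f t * F (x - fun i => b i • t),
    (hm.stronglyMeasurable.integral_prod_right').measurable, fun x => ?_, fun n => ?_⟩
  · refine (norm_integral_le_of_norm_le_const (C := K * A)
      (Filter.Eventually.of_forall fun t => hb (x, t))).trans ?_
    simp
  · simp only [← integral_const_mul]
    rw [integral_integral_swap]
    · have hin : ∀ t : UnitAddCircle, ∫ x : UnitAddTorus (Fin d), UnitAddTorus.mFourier (-n) x *
          (f t * F (x - fun i => b i • t))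
          = fourier (-∑ i, n i * b i) t * f t * a n := by
        intro t
        rw [← integral_add_right_eq_self _ (fun i => b i • t : UnitAddTorus (Fin d)), ← hc,
          ← integral_const_mul]
        refine integral_congr_ae (Filter.Eventually.of_forall fun x => ?_)
        simp only [add_sub_cancel_right, mFourier_add_apply, mFourier_smul_apply, Pi.neg_apply,
          neg_mul, Finset.sum_neg_distrib]
        ring
      simp only [hin]
      rw [integral_mul_const, hc']
    · refine integrable_of_bound (A := K * A) ?_ fun p => ?_
      · exact ((UnitAddTorus.mFourier (-n)).continuous.measurable.comp measurable_fst).mul hm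
      · change ‖UnitAddTorus.mFourier (-n) p.1 * (f p.2 * F (p.1 - fun i => b i • p.2))‖ ≤ K * A
        rw [norm_mul, norm_mFourier_apply, one_mul]
        exact hb p

theorem IsTorusCoeff.skew {a : (Fin d → ℤ) → ℂ} {k : ℤ → ℂ} {A K : ℝ}
    (ha : IsTorusCoeff d a A) (hk : IsCircleCoeff k K) (c : ℤ) :
    IsTorusCoeff (d + 1) (fun n => k (n (Fin.last d)) *
      a fun i => n i.castSucc - c * n (Fin.last d)) (K * A) := by
  obtain ⟨F, hF, hA, hc⟩ := ha
  obtain ⟨f, hf, hK, hc'⟩ := hk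
  have hmF : Measurable fun x : UnitAddTorus (Fin (d + 1)) =>
      f (x (Fin.last d) + c • ∑ i : Fin d, x i.castSucc) * F fun i => x i.castSucc := by
    refine (hf.comp ?_).mul (hF.comp (measurable_pi_lambda _ fun i => measurable_pi_apply _))
    have : Continuous fun x : UnitAddTorus (Fin (d + 1)) =>
      x (Fin.last d) + c • ∑ i : Fin d, x i.castSucc := by fun_prop
    exact this.measurable
  have hb : ∀ x : UnitAddTorus (Fin (d + 1)),
      ‖f (x (Fin.last d) + c • ∑ i : Fin d, x i.castSucc) * F fun i => x i.castSucc‖ ≤ K * A :=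
    fun x => by
      rw [norm_mul]
      exact mul_le_mul (hK _) (hA _) (norm_nonneg _) ((norm_nonneg _).trans (hK 0))
  refine ⟨_, hmF, hb, fun n => ?_⟩
  beta_reduce
  have hmp := (volume_preserving_piFinSuccAbove
    (fun _ : Fin (d + 1) => UnitAddCircle) (Fin.last d)).symm
  have hlast : ∀ p : UnitAddCircle × (Fin d → UnitAddCircle),
      (MeasurableEquiv.piFinSuccAbove (fun _ : Fin (d + 1) => UnitAddCircle) (Fin.last d)).symm p
        (Fin.last d) = p.1 := fun p => by simp [MeasurableEquiv.piFinSuccAbove]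
  have hinit : ∀ (p : UnitAddCircle × (Fin d → UnitAddCircle)) (i : Fin d),
      (MeasurableEquiv.piFinSuccAbove (fun _ : Fin (d + 1) => UnitAddCircle) (Fin.last d)).symm p
        i.castSucc = p.2 i := fun p i => by simp [MeasurableEquiv.piFinSuccAbove]
  rw [← hmp.integral_comp', Measure.volume_eq_prod, integral_prod_symm]
  · rw [← hc, ← integral_const_mul]
    refine integral_congr_ae (Filter.Eventually.of_forall fun x => ?_)
    beta_reduce
    simp only [UnitAddTorus.mFourier, ContinuousMap.coe_mk, Fin.prod_univ_castSucc, hlast, hinit]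
    rw [← integral_add_right_eq_self _ (-(c • ∑ i, x i)), ← hc', ← integral_mul_const]
    refine integral_congr_ae (Filter.Eventually.of_forall fun t => ?_)
    beta_reduce
    have h1 : (fourier ((-n) (Fin.last d)) (-(c • ∑ i, x i)) : ℂ)
        = ∏ i, fourier (n (Fin.last d) * c) (x i) := by
      rw [← fourier_sum_apply, ← neg_smul, fourier_zsmul_apply]
      simp
    have h2 : ∏ i, (fourier (-(fun i : Fin d => n i.castSucc - c * n (Fin.last d)) i) (x i) : ℂ)
        = (∏ i : Fin d, fourier ((-n) i.castSucc) (x i)) *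
          ∏ i, fourier (n (Fin.last d) * c) (x i) := by
      rw [← Finset.prod_mul_distrib]
      refine Finset.prod_congr rfl fun i _ => ?_
      rw [← fourier_add]
      congr 1
      simp only [Pi.neg_apply]
      ring_nf
    simp only [Pi.neg_apply (i := Fin.last d)] at h1 ⊢
    rw [fourier_add_apply, h1, neg_add_cancel_right]
    simp only [Pi.neg_apply] at h2 ⊢
    rw [h2]
    ring
  · exact hmp.integrable_comp_of_integrable (integrable_mFourier_mul _ hmF hb)

end Torus

section Kernels

variable {d : ℕ}

theorem measurable_periodizedBernoulli (k : ℕ) : Measurable (periodizedBernoulli k) := by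
  have h : Measurable fun t : UnitAddCircle => (AddCircle.measurableEquivIco 1 0 t : ℝ) :=
    measurable_subtype_coe.comp (AddCircle.measurableEquivIco 1 0).measurable
  exact (Polynomial.continuous _).measurable.comp h

theorem exists_periodizedBernoulli_eq (t : UnitAddCircle) :
    ∃ x ∈ Set.Icc (0 : ℝ) 1, ∀ k, periodizedBernoulli k t = bernoulliFun k x := by
  refine ⟨AddCircle.equivIco 1 0 t, ?_, fun k => rfl⟩
  have h := (AddCircle.equivIco 1 0 t).2
  exact ⟨h.1, h.2.le.trans (zero_add _).le⟩

theorem abs_bernoulliFun_div_factorial_le {k : ℕ} (hk : 1 ≤ k) {x : ℝ}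
    (hx : x ∈ Set.Icc (0 : ℝ) 1) :
    |bernoulliFun k x / k.factorial| ≤
      (2 * π + ∑' n : ℤ, 1 / (n : ℝ) ^ 2) * (1 / (2 * π)) ^ k := by
  have hS : 0 ≤ ∑' n : ℤ, 1 / (n : ℝ) ^ 2 := tsum_nonneg fun n => by positivity
  have hpi : 0 < 2 * π := by positivity
  rcases hk.eq_or_lt with rfl | hk2
  · rw [bernoulliFun_one, Nat.factorial_one, Nat.cast_one, div_one, pow_one, add_mul,
      mul_one_div_cancel hpi.ne']
    have : |x - 1 / 2| ≤ 1 := by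
      rw [abs_le]
      constructor <;> linarith [hx.1, hx.2]
    have h2 : 0 ≤ (∑' n : ℤ, 1 / (n : ℝ) ^ 2) * (1 / (2 * π)) := by positivity
    linarith
  · have hs := hasSum_one_div_pow_mul_fourier_mul_bernoulliFun hk2 hx
    have hsum : Summable fun n : ℤ => 1 / (n : ℝ) ^ 2 :=
      Real.summable_one_div_int_pow.mpr one_lt_two
    have hle : ∀ n : ℤ, ‖1 / (n : ℂ) ^ k * (fourier n (x : UnitAddCircle) : ℂ)‖ ≤
        1 / (n : ℝ) ^ 2 := fun n => by
      rw [norm_mul, show ‖(fourier n (x : UnitAddCircle) : ℂ)‖ = 1 from Circle.norm_coe _, mul_one]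
      rcases eq_or_ne n 0 with rfl | hn
      · simp [show k ≠ 0 by omega]
      · rw [norm_div, norm_one, norm_pow, Complex.norm_intCast, ← sq_abs]
        have h1 : (1 : ℝ) ≤ |(n : ℝ)| := by exact_mod_cast Int.one_le_abs hn
        exact one_div_le_one_div_of_le (by positivity) (pow_le_pow_right₀ h1 hk2)
    have hb := tsum_of_norm_bounded hsum.hasSum hle
    rw [hs.tsum_eq] at hb
    have hn : ‖-(2 * π * Complex.I) ^ k / (k.factorial : ℂ) * bernoulliFun k x‖
        = (2 * π) ^ k * |bernoulliFun k x / k.factorial| := by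
      rw [norm_mul, norm_div, norm_neg, norm_pow, norm_mul, norm_mul, Complex.norm_I,
        Complex.norm_real, Complex.norm_real, Complex.norm_natCast, abs_div, Nat.abs_cast,
        Real.norm_eq_abs, Real.norm_eq_abs, abs_of_pos Real.pi_pos]
      simp
      ring
    rw [hn] at hb
    rw [one_div_pow, mul_one_div, le_div_iff₀ (by positivity), mul_comm]
    linarith

theorem isCircleCoeff_inv_pow {k : ℕ} (hk : 1 ≤ k) :
    IsCircleCoeff (fun m => ((2 * π * Complex.I * m) ^ k)⁻¹)
      ((2 * π + ∑' n : ℤ, 1 / (n : ℝ) ^ 2) * (1 / (2 * π)) ^ k) := by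
  refine ⟨fun t => -(k.factorial : ℂ)⁻¹ * (periodizedBernoulli k t : ℂ),
    (Complex.measurable_ofReal.comp (measurable_periodizedBernoulli k)).const_mul _,
    fun t => ?_, fun m => ?_⟩
  · obtain ⟨x, hx, hk'⟩ := exists_periodizedBernoulli_eq t
    refine le_trans (le_of_eq ?_) (abs_bernoulliFun_div_factorial_le hk hx)
    beta_reduce
    rw [hk', norm_mul, norm_neg, norm_inv, Complex.norm_real, Complex.norm_natCast, abs_div,
      Nat.abs_cast, Real.norm_eq_abs]
    ring
  · have h := fourierCoeff_bernoulli_eq (show k ≠ 0 by omega) m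
    rw [← integral_fourier_mul] at h
    simp only [mul_left_comm _ (-(k.factorial : ℂ)⁻¹)]
    rw [integral_const_mul]
    simp only [Function.comp_apply] at h
    rw [h, neg_div, neg_mul_neg, mul_div, inv_mul_cancel₀, one_div]
    exact_mod_cast k.factorial_ne_zero

/-- Restricting a coefficient sequence to the solutions of `n · b = 0`, or to the complement. -/
theorem IsTorusCoeff.restrict_dot {a : (Fin d → ℤ) → ℂ} {A : ℝ} (ha : IsTorusCoeff d a A)
    (b : Fin d → ℤ) (p : Prop) [∀ n : Fin d → ℤ, Decidable (∑ i, n i * b i = 0 ↔ p)] :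
    IsTorusCoeff d (fun n => if (∑ i, n i * b i = 0 ↔ p) then a n else 0) (2 * A) := by
  have h0 := ha.nonneg
  have h := ha.convolve isCircleCoeff_one b
  by_cases hp : p
  · refine (h.mono (by linarith : 1 * A ≤ 2 * A)).congr fun n => ?_
    by_cases hn : ∑ i, n i * b i = 0 <;> simp [hn, hp]
  · refine ((ha.sub h).mono (by linarith : A + 1 * A ≤ 2 * A)).congr fun n => ?_
    by_cases hn : ∑ i, n i * b i = 0 <;> simp [hn, hp]

/-- The vectors `baseVec` have integer coordinates. -/
def baseVecInt (d : ℕ) (v : Fin d → Bool) (k : Fin d) : Fin d → ℤ := fun i =>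
  (if i = k then 1 else 0) -
    (if k < i ∧ v i = true ∧ (∀ m : Fin d, k < m → v m = true → i ≤ m) then 1 else 0)

theorem cast_baseVecInt (v : Fin d → Bool) (k i : Fin d) :
    (baseVecInt d v k i : ℝ) = baseVec d v k i := by
  simp [baseVecInt, baseVec]

theorem intCast_mem_Qset_iff {θ : Set (Fin d → ℝ)} {n : Fin d → ℤ} :
    (fun i => (n i : ℝ)) ∈ Qset d θ ↔
      ∀ p : (Fin d → Bool) × Fin d,
        (∑ i, n i * baseVecInt d p.1 p.2 i = 0 ↔ baseVec d p.1 p.2 ∈ θ) := by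
  have h : ∀ v k, (∑ i, (n i : ℝ) * baseVec d v k i = 0) ↔
      ∑ i, n i * baseVecInt d v k i = 0 := fun v k => by
    simp only [← cast_baseVecInt]
    exact_mod_cast Iff.rfl
  constructor
  · rintro hn ⟨v, k⟩
    rw [← h]
    exact hn _ ⟨v, k, rfl⟩
  · rintro hn b ⟨v, k, rfl⟩
    rw [h]
    exact hn (v, k)

open Classical in
theorem IsTorusCoeff.restrict_Qset {a : (Fin d → ℤ) → ℂ} {A : ℝ} (ha : IsTorusCoeff d a A)
    (θ : Set (Fin d → ℝ)) :
    IsTorusCoeff d (fun n => if (fun i => (n i : ℝ)) ∈ Qset d θ then a n else 0)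
      (2 ^ Fintype.card ((Fin d → Bool) × Fin d) * A) := by
  have h : ∀ s : Finset ((Fin d → Bool) × Fin d),
      IsTorusCoeff d (fun n => if ∀ p ∈ s, (∑ i, n i * baseVecInt d p.1 p.2 i = 0 ↔
        baseVec d p.1 p.2 ∈ θ) then a n else 0) (2 ^ s.card * A) := by
    intro s
    induction s using Finset.induction_on with
    | empty => simpa using ha
    | insert p s hp ih =>
      rw [Finset.card_insert_of_notMem hp, pow_succ', mul_assoc]
      refine (ih.restrict_dot (baseVecInt d p.1 p.2) (baseVec d p.1 p.2 ∈ θ)).congr fun n => ?_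
      rw [← ite_and]
      exact if_congr (by rw [Finset.forall_mem_insert]) rfl rfl
  refine (h Finset.univ).congr fun n => if_congr ?_ rfl rfl
  simp [intCast_mem_Qset_iff]

end Kernels

section Periodization

variable {d : ℕ}

/-- The half-open unit cube. -/
def unitCube (d : ℕ) : Set (Fin d → ℝ) := Set.univ.pi fun _ => Set.Ico (0 : ℝ) 1

theorem measurableSet_unitCube (d : ℕ) : MeasurableSet (unitCube d) :=
  MeasurableSet.univ_pi fun _ => measurableSet_Ico

theorem measurePreserving_torus_mk (d : ℕ) :
    MeasurePreserving (fun (x : Fin d → ℝ) (i : Fin d) => (x i : UnitAddCircle))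
      (volume.restrict (unitCube d)) volume := by
  have h1 : (volume : Measure (Fin d → ℝ)).restrict (unitCube d)
      = Measure.pi fun _ : Fin d => volume.restrict (Set.Ioc (0 : ℝ) (0 + 1)) := by
    rw [unitCube, volume_pi, Measure.restrict_pi_pi]
    congr 1
    funext i
    rw [zero_add]
    exact Measure.restrict_congr_set Ico_ae_eq_Ioc
  rw [h1, volume_pi]
  exact measurePreserving_pi _ _ fun _ => UnitAddCircle.measurePreserving_mk 0

theorem integral_torus_eq {H : UnitAddTorus (Fin d) → ℂ} (hH : Measurable H) :
    ∫ x, H x = ∫ x in unitCube d, H fun i => (x i : UnitAddCircle) := by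
  rw [← (measurePreserving_torus_mk d).map_eq,
    integral_map (measurePreserving_torus_mk d).aemeasurable hH.aestronglyMeasurable]

theorem mFourier_neg_coe (n : Fin d → ℤ) (x : Fin d → ℝ) :
    UnitAddTorus.mFourier (-n) (fun i => (x i : UnitAddCircle)) =
      expDot d (fun i => (n i : ℝ)) x := by
  simp only [UnitAddTorus.mFourier, ContinuousMap.coe_mk, Pi.neg_apply, fourier_coe_apply, expDot,
    ← Complex.exp_sum]
  congr 1
  push_cast
  rw [Finset.mul_sum]
  refine Finset.sum_congr rfl fun i _ => ?_
  rw [div_one]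
  ring

theorem IsTorusCoeff.exists_periodic {a : (Fin d → ℤ) → ℂ} {A : ℝ} (h : IsTorusCoeff d a A) :
    ∃ G : (Fin d → ℝ) → ℂ,
      (∀ (x : Fin d → ℝ) (m : Fin d → ℤ), G (x + fun i => (m i : ℝ)) = G x) ∧
      (∀ n, tFC d G n = a n) ∧ ∀ x, ‖G x‖ ≤ A := by
  obtain ⟨F, hF, hA, hc⟩ := h
  refine ⟨fun x => F fun i => (x i : UnitAddCircle), fun x m => ?_, fun n => ?_, fun x => hA _⟩
  · refine congrArg F (funext fun i => ?_)
    have : ((m i : ℝ) : UnitAddCircle) = 0 :=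
      (AddCircle.coe_eq_zero_iff 1).mpr ⟨m i, by simp⟩
    rw [Pi.add_apply, AddCircle.coe_add, this, add_zero]
  · rw [← hc, integral_torus_eq (measurable_mFourier_mul _ hF)]
    simp only [mFourier_neg_coe, tFC, mul_comm (expDot _ _ _)]
    rfl

theorem expDot_add_natCast (n : Fin d → ℤ) (x : Fin d → ℝ) (k : Fin d → ℕ) :
    expDot d (fun i => (n i : ℝ)) (x + fun i => (k i : ℝ)) = expDot d (fun i => (n i : ℝ)) x := by
  rw [expDot, expDot, Complex.exp_eq_exp_iff_exists_int]
  refine ⟨-∑ i, n i * k i, ?_⟩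
  simp only [Pi.add_apply, mul_add, Finset.sum_add_distrib]
  push_cast
  ring

theorem sum_indicator_unitCube {N : ℕ} (F : (Fin d → ℝ) → ℂ)
    (hF : ∀ y, F y ≠ 0 → ∀ i, 0 ≤ y i ∧ y i < N) (y : Fin d → ℝ) :
    ∑ k ∈ Fintype.piFinset fun _ : Fin d => Finset.range N,
      (unitCube d).indicator (fun x => F (x + fun i => (k i : ℝ))) (y - fun i => (k i : ℝ))
        = F y := by
  by_cases h0 : F y = 0
  · rw [h0]
    refine Finset.sum_eq_zero fun k _ => ?_
    simp [h0]
  · have hy := hF y h0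
    rw [Finset.sum_eq_single fun i => ⌊y i⌋₊]
    · rw [Set.indicator_of_mem, sub_add_cancel]
      intro i _
      exact ⟨sub_nonneg.mpr (Nat.floor_le (hy i).1), by
        have := Nat.lt_floor_add_one (y i)
        simp only [Pi.sub_apply]
        linarith⟩
    · intro k _ hk
      refine Set.indicator_of_notMem (fun hm => hk ?_) _
      funext i
      have hi := hm i trivial
      simp only [Pi.sub_apply, Set.mem_Ico] at hi
      exact ((Nat.floor_eq_iff (hy i).1).mpr ⟨by linarith, by linarith⟩).symm
    · intro hk
      refine absurd ?_ hk
      rw [Fintype.mem_piFinset]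
      exact fun i => Finset.mem_range.mpr ((Nat.floor_lt (hy i).1).mpr (hy i).2)

theorem integral_eq_sum_unitCube {N : ℕ} {F : (Fin d → ℝ) → ℂ} (hFi : Integrable F)
    (hF : ∀ y, F y ≠ 0 → ∀ i, 0 ≤ y i ∧ y i < N) :
    ∫ y, F y = ∑ k ∈ Fintype.piFinset fun _ : Fin d => Finset.range N,
      ∫ x in unitCube d, F (x + fun i => (k i : ℝ)) := by
  have hintegrable : ∀ k : Fin d → ℕ, Integrable
      ((unitCube d).indicator fun x => F (x + fun i => (k i : ℝ))) := fun k =>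
    (hFi.comp_add_right _).indicator (measurableSet_unitCube d)
  calc ∫ y, F y = ∫ y, ∑ k ∈ Fintype.piFinset fun _ : Fin d => Finset.range N,
        (unitCube d).indicator (fun x => F (x + fun i => (k i : ℝ))) (y - fun i => (k i : ℝ)) := by
        simp only [sum_indicator_unitCube F hF]
    _ = _ := by
      rw [integral_finsetSum _ fun k _ => (hintegrable k).comp_sub_right _]
      refine Finset.sum_congr rfl fun k _ => ?_
      rw [integral_sub_right_eq_self, integral_indicator (measurableSet_unitCube d)]

theorem ftS_smul_eq {τ : ℝ} (hτ : 0 < τ) (g : (Fin d → ℝ) → ℝ) (ξ : Fin d → ℝ) :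
    ftS d g (τ • ξ) = ((τ⁻¹ ^ d : ℝ) : ℂ) *
      ∫ y, (((Sd d).indicator g (τ⁻¹ • y) : ℝ) : ℂ) * expDot d ξ y := by
  have h := Measure.integral_comp_smul (volume : Measure (Fin d → ℝ))
    (fun y => (((Sd d).indicator g (τ⁻¹ • y) : ℝ) : ℂ) * expDot d ξ y) τ
  rw [Module.finrank_fin_fun, abs_of_pos (by positivity), ← inv_pow, Complex.real_smul] at h
  rw [← h, ftS, ft]
  refine integral_congr_ae (Filter.Eventually.of_forall fun x => ?_)
  simp only [smul_smul, inv_mul_cancel₀ hτ.ne', one_smul, expDot, Pi.smul_apply, smul_eq_mul]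
  have hx : ∑ i, τ * ξ i * x i = ∑ i, ξ i * (τ * x i) :=
    Finset.sum_congr rfl fun i _ => by ring
  rw [hx]

theorem measurable_indicator_Sd {g : (Fin d → ℝ) → ℝ} (hg : Continuous g) :
    Measurable ((Sd d).indicator g) :=
  hg.measurable.indicator (measurableSet_Sd d)

theorem integrable_indicator_Sd_smul {g : (Fin d → ℝ) → ℝ} (hg : Continuous g) {τ : ℝ}
    (hτ : 0 < τ) (ξ : Fin d → ℝ) :
    Integrable fun y => (((Sd d).indicator g (τ⁻¹ • y) : ℝ) : ℂ) * expDot d ξ y := by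
  have h1 : Integrable ((Sd d).indicator g) :=
    (hg.continuousOn.integrableOn_compact (isCompact_Sd d)).integrable_indicator
      (measurableSet_Sd d)
  have h2 : Integrable fun y => (Sd d).indicator g (τ⁻¹ • y) :=
    h1.comp_smul (inv_ne_zero hτ.ne')
  refine (h2.ofReal (𝕜 := ℂ)).mul_bdd (c := 1) (continuous_expDot ξ).aestronglyMeasurable ?_
  exact Filter.Eventually.of_forall fun x => (norm_expDot ξ x).le

theorem isTorusCoeff_ftS {g : (Fin d → ℝ) → ℝ} (hg : Continuous g) {M : ℝ}
    (hM : ∀ x ∈ Sd d, |g x| ≤ M) {τ₀ τ : ℝ} (hτ₀ : 0 < τ₀) (hτ : τ₀ < τ) :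
    IsTorusCoeff d (fun n => ftS d g (τ • fun i => (n i : ℝ))) ((1 + 1 / τ₀) ^ d * M) := by
  have hτ' : 0 < τ := hτ₀.trans hτ
  have hM0 : 0 ≤ M := (abs_nonneg _).trans (hM 0 (zero_mem_Sd d))
  set N : ℕ := ⌊τ⌋₊ + 1 with hN
  set P : (Fin d → ℝ) → ℂ := fun x => ((τ⁻¹ ^ d : ℝ) : ℂ) *
    ∑ k ∈ Fintype.piFinset fun _ : Fin d => Finset.range N,
      (((Sd d).indicator g (τ⁻¹ • (x + fun i => (k i : ℝ))) : ℝ) : ℂ) with hP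
  have hmeas : ∀ k : Fin d → ℕ, Measurable fun x : Fin d → ℝ =>
      (((Sd d).indicator g (τ⁻¹ • (x + fun i => (k i : ℝ))) : ℝ) : ℂ) := fun k =>
    Complex.measurable_ofReal.comp ((measurable_indicator_Sd hg).comp
      ((measurable_id.add_const _).const_smul τ⁻¹))
  have hPm : Measurable P :=
    (Finset.measurable_sum _ fun k _ => hmeas k).const_mul _
  have hPb : ∀ x, ‖P x‖ ≤ (1 + 1 / τ₀) ^ d * M := fun x => by
    have h1 : ‖∑ k ∈ Fintype.piFinset fun _ : Fin d => Finset.range N,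
      (((Sd d).indicator g (τ⁻¹ • (x + fun i => (k i : ℝ))) : ℝ) : ℂ)‖ ≤ (N : ℝ) ^ d * M := by
      refine (norm_sum_le_of_le (n := fun _ => M) _ fun k _ => ?_).trans (by simp)
      rw [Complex.norm_real]
      by_cases h : τ⁻¹ • (x + fun i => (k i : ℝ)) ∈ Sd d
      · rw [Set.indicator_of_mem h]
        exact hM _ h
      · rwa [Set.indicator_of_notMem h, norm_zero]
    rw [norm_mul, Complex.norm_real, Real.norm_of_nonneg (by positivity)]
    refine (mul_le_mul_of_nonneg_left h1 (by positivity)).trans ?_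
    rw [← mul_assoc, ← mul_pow]
    refine mul_le_mul_of_nonneg_right (pow_le_pow_left₀ (by positivity) ?_ _) hM0
    have h2 : (N : ℝ) ≤ τ + 1 := by
      rw [hN]; push_cast; linarith [Nat.floor_le hτ'.le]
    calc τ⁻¹ * N ≤ τ⁻¹ * (τ + 1) := by gcongr
      _ = 1 + 1 / τ := by field_simp
      _ ≤ 1 + 1 / τ₀ := by gcongr
  have hlift : Measurable fun (x : UnitAddTorus (Fin d)) (i : Fin d) =>
      (AddCircle.measurableEquivIco 1 0 (x i) : ℝ) :=
    measurable_pi_lambda _ fun i => measurable_subtype_coe.comp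
      ((AddCircle.measurableEquivIco 1 0).measurable.comp (measurable_pi_apply i))
  have hPl : Measurable fun x : UnitAddTorus (Fin d) =>
    P fun i => (AddCircle.measurableEquivIco 1 0 (x i) : ℝ) := hPm.comp hlift
  refine ⟨_, hPl, fun x => hPb _, fun n => ?_⟩
  have hsupp : ∀ y : Fin d → ℝ, (((Sd d).indicator g (τ⁻¹ • y) : ℝ) : ℂ) *
      expDot d (fun i => (n i : ℝ)) y ≠ 0 → ∀ i, 0 ≤ y i ∧ y i < N := by
    intro y hy i
    have hmem : τ⁻¹ • y ∈ Sd d := by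
      by_contra h
      exact hy (by simp [Set.indicator_of_notMem h])
    have h0 : 0 ≤ τ⁻¹ * y i := hmem.1 i
    have h1 : τ⁻¹ * y i ≤ 1 :=
      (Finset.single_le_sum (fun j _ => hmem.1 j) (Finset.mem_univ i)).trans hmem.2
    refine ⟨nonneg_of_mul_nonneg_right h0 (inv_pos.mpr hτ'), ?_⟩
    rw [inv_mul_le_iff₀ hτ', mul_one] at h1
    rw [hN]
    push_cast
    exact h1.trans_lt (Nat.lt_floor_add_one τ)
  have hintegrable := integrable_indicator_Sd_smul hg hτ' fun i => (n i : ℝ)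
  beta_reduce
  rw [integral_torus_eq (measurable_mFourier_mul _ hPl), ftS_smul_eq hτ',
    integral_eq_sum_unitCube hintegrable hsupp]
  simp only [expDot_add_natCast]
  rw [← integral_finsetSum, ← integral_const_mul]
  · refine setIntegral_congr_fun (measurableSet_unitCube d) fun x hx => ?_
    have hx' : (fun i => (AddCircle.measurableEquivIco 1 0 (x i : UnitAddCircle) : ℝ)) = x := by
      funext i
      have hi : x i ∈ Set.Ico (0 : ℝ) (0 + 1) := by
        rw [zero_add]
        exact hx i trivial
      exact congrArg Subtype.val (AddCircle.equivIco_coe_eq hi)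
    simp only [mFourier_neg_coe, hx', hP, Finset.mul_sum]
    exact Finset.sum_congr rfl fun k _ => by ring
  · intro k _
    have := (hintegrable.comp_add_right fun i => (k i : ℝ)).integrableOn (s := unitCube d)
    simp only [expDot_add_natCast] at this
    exact this

end Periodization

section RemainderBound

variable {d : ℕ}

/-- `M` bounds on the simplex the partial derivatives of `g` of the orders that enter the estimate
of the remainder of order `w`. -/
def DerivBound (d w : ℕ) (g : (Fin d → ℝ) → ℝ) (M : ℝ) : Prop :=
  ∀ l : List (Fin d), w + 2 ≤ l.length + d → l.length ≤ w + 1 →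
    ∀ x ∈ Sd d, |pderivL d l g x| ≤ M

theorem slantFactor_pow_mul_le {a b : ℕ} (hab : a ≤ b) {M : ℝ} (hM : 0 ≤ M) :
    slantFactor d ^ a * M ≤ slantFactor d ^ b * M :=
  mul_le_mul_of_nonneg_right (pow_le_pow_right₀ (one_le_slantFactor d) hab) hM

theorem DerivBound.fiberIntegral {w : ℕ} {g : (Fin (d + 1) → ℝ) → ℝ} {M : ℝ} (hM0 : 0 ≤ M)
    (hg : ContDiff ℝ (w + 1 : ℕ) g) (hM : DerivBound (d + 1) w g M) :
    DerivBound d w (fiberIntegral d g) (slantFactor d ^ (w + 1) * M) := by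
  intro l h1 h2 x hx
  refine (abs_pderivL_fiberIntegral_le l (hg.of_le (by exact_mod_cast h2)) (fun l' h3 h4 =>
    hM l' (by omega) (by omega)) hx).trans (slantFactor_pow_mul_le h2 hM0)

theorem ContDiff.pderivI_iterate_sub {w j : ℕ} (hj : j ≤ w) {g : (Fin d → ℝ) → ℝ}
    (hg : ContDiff ℝ (w + 1 : ℕ) g) (i : Fin d) :
    ContDiff ℝ (w - j + 1 : ℕ) ((_root_.pderivI d i)^[j] g) :=
  ContDiff.pderivI_iterate (hg.of_le (by norm_cast; omega)) i

theorem DerivBound.faceSum_iterate {w j : ℕ} (hj : j ≤ w) {g : (Fin (d + 1) → ℝ) → ℝ} {M : ℝ}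
    (hM0 : 0 ≤ M) (hg : ContDiff ℝ (w + 1 : ℕ) g) (hM : DerivBound (d + 1) w g M) :
    DerivBound d (w - j) (faceSum d ((pderivI (d + 1) (Fin.last d))^[j] g))
      (slantFactor d ^ (w - j + 1) * M) := by
  intro l h1 h2 x hx
  refine (abs_pderivL_faceSum_le l ((hg.pderivI_iterate_sub hj _).of_le (by exact_mod_cast h2))
    (fun l' h3 y hy => ?_) hx).trans (slantFactor_pow_mul_le h2 hM0)
  rw [pderivL_iterate]
  exact hM _ (by simp; omega) (by simp; omega) y hy

theorem DerivBound.faceZero_iterate {w j : ℕ} (hj : j ≤ w) {g : (Fin (d + 1) → ℝ) → ℝ} {M : ℝ}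
    (hM0 : 0 ≤ M) (hg : ContDiff ℝ (w + 1 : ℕ) g) (hM : DerivBound (d + 1) w g M) :
    DerivBound d (w - j) (faceZero d ((pderivI (d + 1) (Fin.last d))^[j] g))
      (slantFactor d ^ (w - j + 1) * M) := by
  intro l h1 h2 x hx
  rw [pderivL_faceZero l ((hg.pderivI_iterate_sub hj _).of_le (by exact_mod_cast h2))]
  refine le_trans ?_ (le_mul_of_one_le_left hM0 (one_le_pow₀ (one_le_slantFactor d)))
  rw [faceZero, pderivL_iterate]
  exact hM _ (by simp; omega) (by simp; omega) _ (snocCLM_faceZero_mem hx)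

theorem freqInit_smul_intCast (τ : ℝ) (n : Fin (d + 1) → ℤ) :
    freqInit d (τ • fun i => (n i : ℝ)) =
      τ • fun i => ((n (Fin.castSucc i) - 0 * n (Fin.last d) : ℤ) : ℝ) := by
  funext i
  simp [freqInit]

theorem freqSlant_smul_intCast (τ : ℝ) (n : Fin (d + 1) → ℤ) :
    freqSlant d (τ • fun i => (n i : ℝ)) =
      τ • fun i => ((n (Fin.castSucc i) - 1 * n (Fin.last d) : ℤ) : ℝ) := by
  funext i
  simp [freqSlant, mul_sub]

theorem intCast_mem_Qset_traceZero {θ : Set (Fin (d + 1) → ℝ)} {n : Fin (d + 1) → ℤ}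
    (h : (fun i => (n i : ℝ)) ∈ Qset (d + 1) θ) :
    (fun i => ((n (Fin.castSucc i) - 0 * n (Fin.last d) : ℤ) : ℝ)) ∈ Qset d (traceZero d θ) := by
  have := freqInit_smul_intCast 1 n
  rw [one_smul, one_smul] at this
  exact this ▸ freqInit_mem_Qset h

theorem intCast_mem_Qset_traceSum {θ : Set (Fin (d + 1) → ℝ)} {n : Fin (d + 1) → ℤ}
    (h : (fun i => (n i : ℝ)) ∈ Qset (d + 1) θ) :
    (fun i => ((n (Fin.castSucc i) - 1 * n (Fin.last d) : ℤ) : ℝ)) ∈ Qset d (traceSum d θ) := by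
  have := freqSlant_smul_intCast 1 n
  rw [one_smul, one_smul] at this
  exact this ▸ freqSlant_mem_Qset h

theorem face_term_bound {C U M Ω τ₀ τ ω : ℝ} (hC : 0 ≤ C) (hU : 0 ≤ U) (hM : 0 ≤ M) (hω : 0 ≤ ω)
    (hΩ : 0 < Ω) (hτ₀ : 0 < τ₀) (hτ : τ₀ < τ) {w j : ℕ} (hj : j ≤ w) :
    ‖((τ : ℂ) ^ (j + 1))⁻¹‖ * ((C * ω ^ (j + 1)) *
      (U * (2 ^ (d - 1) * Ω * τ⁻¹) ^ (w - j + 1) * (slantFactor d ^ (w - j + 1) * M))) ≤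
    C * U * (ω / τ₀) * (2 ^ (d + 1 - 1) * Ω * τ⁻¹) ^ (w + 1) * M * (ω / Ω) ^ j := by
  obtain ⟨m, rfl⟩ := Nat.exists_eq_add_of_le hj
  have hτ' : 0 < τ := hτ₀.trans hτ
  have hD : (1 : ℝ) ≤ 2 ^ (d + 1 - 1) := one_le_pow₀ one_le_two
  rw [norm_inv, norm_pow, Complex.norm_real, Real.norm_of_nonneg hτ'.le, Nat.add_sub_cancel_left,
    ← pow_mul_slantFactor] at *
  set D : ℝ := 2 ^ (d - 1) * slantFactor d
  have h1 : (2 ^ (d - 1) * Ω * τ⁻¹) ^ (m + 1) * (slantFactor d ^ (m + 1) * M)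
      = (D * Ω * τ⁻¹) ^ (m + 1) * M := by
    rw [← mul_assoc, ← mul_pow]
    congr 2
    ring
  have h2 : (τ ^ (j + 1))⁻¹ * ω ^ (j + 1) ≤
      (ω / τ₀) * (D * Ω * τ⁻¹) ^ j * (ω / Ω) ^ j := by
    have h3 : (ω / τ₀) * (D * Ω * τ⁻¹) ^ j * (ω / Ω) ^ j
        = τ₀⁻¹ * ω ^ (j + 1) * (τ⁻¹) ^ j * D ^ j := by
      simp only [div_eq_mul_inv, mul_pow, pow_succ]
      have : Ω ^ j * (Ω⁻¹) ^ j = 1 := by rw [← mul_pow, mul_inv_cancel₀ hΩ.ne', one_pow]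
      linear_combination (ω * τ₀⁻¹ * D ^ j * (τ⁻¹) ^ j * ω ^ j) * this
    have h4 : (τ ^ (j + 1))⁻¹ * ω ^ (j + 1) = τ⁻¹ * ω ^ (j + 1) * (τ⁻¹) ^ j * 1 := by
      rw [← inv_pow, pow_succ]
      ring
    rw [h3, h4]
    gcongr
    exact one_le_pow₀ hD
  calc _ = ((τ ^ (j + 1))⁻¹ * ω ^ (j + 1)) * (C * U * ((2 ^ (d - 1) * Ω * τ⁻¹) ^ (m + 1) *
        (slantFactor d ^ (m + 1) * M))) := by ring
    _ ≤ ((ω / τ₀) * (D * Ω * τ⁻¹) ^ j * (ω / Ω) ^ j) * (C * U * ((D * Ω * τ⁻¹) ^ (m + 1) * M)) := by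
      rw [h1]
      exact mul_le_mul_of_nonneg_right h2 (by positivity)
    _ = _ := by ring

theorem interior_term_bound {C M Ω τ ω E : ℝ} (hC : 0 ≤ C) (hM : 0 ≤ M) (hω : 0 ≤ ω)
    (hΩ : ω ≤ Ω) (hτ : 0 < τ) (hE : 0 ≤ E) (w : ℕ) :
    ‖((τ : ℂ) ^ (w + 1))⁻¹‖ * ((C * ω ^ (w + 1)) * (E * M)) ≤
      C * E * (2 ^ (d + 1 - 1) * Ω * τ⁻¹) ^ (w + 1) * M := by
  rw [norm_inv, norm_pow, Complex.norm_real, Real.norm_of_nonneg hτ.le, ← inv_pow]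
  have hD : (1 : ℝ) ≤ 2 ^ (d + 1 - 1) := one_le_pow₀ one_le_two
  calc _ = C * E * (1 * ω * τ⁻¹) ^ (w + 1) * M := by
        rw [mul_pow, one_mul]
        ring
    _ ≤ _ := by gcongr

theorem inv_pow_mul_intCast (τ : ℝ) (m : ℤ) (j : ℕ) :
    ((2 * π * Complex.I * ((τ * (m : ℝ) : ℝ) : ℂ)) ^ j)⁻¹ =
      ((τ : ℂ) ^ j)⁻¹ * ((2 * π * Complex.I * m) ^ j)⁻¹ := by
  rw [← mul_inv, ← mul_pow]
  congr 2
  push_cast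
  ring

open Classical in
theorem exists_isTorusCoeff_rem (d : ℕ) {Ω τ₀ : ℝ} (hΩ : 1 / (2 * π) < Ω) (hτ₀ : 0 < τ₀) :
    ∃ U : ℝ, 0 < U ∧ ∀ (θ : Set (Fin d → ℝ)) (τ : ℝ), τ₀ < τ → ∀ (w : ℕ) (g : (Fin d → ℝ) → ℝ),
      ContDiff ℝ (w + 1 : ℕ) g → ∀ M : ℝ, 0 ≤ M → DerivBound d w g M →
        IsTorusCoeff d (fun n => if (fun i => (n i : ℝ)) ∈ Qset d θ then
          rem d θ w g (τ • fun i => (n i : ℝ)) else 0)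
          (U * (2 ^ (d - 1) * Ω * τ⁻¹) ^ (w + 1) * M) := by
  have hω : 0 < 1 / (2 * π) := by positivity
  have hΩ0 : 0 < Ω := hω.trans hΩ
  induction d with
  | zero =>
    refine ⟨1, one_pos, fun θ τ hτ w g hg M hM _ => ?_⟩
    have hτ' : 0 < τ := hτ₀.trans hτ
    refine (IsTorusCoeff.zero.mono (by positivity)).congr fun n => ?_
    simp [rem_zero]
  | succ d ih =>
    obtain ⟨U, hU, ih⟩ := ih
    have hS : 0 ≤ ∑' n : ℤ, 1 / (n : ℝ) ^ 2 := tsum_nonneg fun n => by positivity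
    have hCpos : 0 < 2 * π + ∑' n : ℤ, 1 / (n : ℝ) ^ 2 := by positivity
    have hker := fun j : ℕ => isCircleCoeff_inv_pow (k := j + 1) (by omega)
    set C : ℝ := 2 * π + ∑' n : ℤ, 1 / (n : ℝ) ^ 2
    set ω : ℝ := 1 / (2 * π)
    have hr0 : 0 ≤ ω / Ω := by positivity
    have hr1 : ω / Ω < 1 := (div_lt_one hΩ0).mpr hΩ
    set K : ℝ := 2 ^ Fintype.card ((Fin (d + 1) → Bool) × Fin (d + 1)) with hK
    have hr2 : 0 < 1 - ω / Ω := by linarith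
    refine ⟨K * (U + (2 * (C * U * (ω / τ₀)) * (1 - ω / Ω)⁻¹ + C * (1 + 1 / τ₀) ^ (d + 1))),
      by positivity, fun θ τ hτ w g hg M hM0 hM => ?_⟩
    have hτ' : 0 < τ := hτ₀.trans hτ
    have hD : (0 : ℝ) ≤ 2 ^ (d + 1 - 1) * Ω * τ⁻¹ := by positivity
    by_cases hθ : Pi.single (Fin.last d) 1 ∈ θ
    · have h1 := ((ih (traceZero d θ) τ hτ w (fiberIntegral d g) (contDiff_fiberIntegral hg) _
        (mul_nonneg (pow_nonneg (zero_le_one.trans (one_le_slantFactor d)) _) hM0)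
        (hM.fiberIntegral hM0 hg)).skew isCircleCoeff_one 0).restrict_Qset θ
      refine (h1.mono ?_).congr fun n => ?_
      · rw [one_mul, ← hK]
        have h2 : U * (2 ^ (d - 1) * Ω * τ⁻¹) ^ (w + 1) * (slantFactor d ^ (w + 1) * M)
            = U * (2 ^ (d + 1 - 1) * Ω * τ⁻¹) ^ (w + 1) * M := by
          rw [← pow_mul_slantFactor]
          simp only [mul_pow]
          ring
        rw [h2]
        have h3 : 0 ≤ 2 * (C * U * (ω / τ₀)) * (1 - ω / Ω)⁻¹ + C * (1 + 1 / τ₀) ^ (d + 1) := by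
          positivity
        calc _ = K * U * (2 ^ (d + 1 - 1) * Ω * τ⁻¹) ^ (w + 1) * M := by ring
          _ ≤ _ := by
            gcongr
            linarith
      · refine if_ctx_congr Iff.rfl (fun hn => ?_) fun _ => rfl
        have hlast : n (Fin.last d) = 0 := by
          exact_mod_cast (last_eq_zero_iff hn).mpr hθ
        rw [if_pos hlast, if_pos (intCast_mem_Qset_traceZero hn), one_mul,
          rem_succ_of_mem hθ hg.continuous (by simp [hlast]), freqInit_smul_intCast]
    · have hsl : 0 ≤ slantFactor d := zero_le_one.trans (one_le_slantFactor d)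
      have hfaces := IsTorusCoeff.sum (d := d + 1) (Finset.range (w + 1))
        (fun j hj => by
          have hj' : j ≤ w := Nat.lt_succ_iff.mp (Finset.mem_range.mp hj)
          have h1 := ((ih (traceZero d θ) τ hτ (w - j) _
            (contDiff_faceZero (n := (w - j + 1 : ℕ)) (hg.pderivI_iterate_sub hj' _)) _
            (mul_nonneg (pow_nonneg hsl _) hM0)
            (hM.faceZero_iterate hj' hM0 hg)).skew (hker j) 0).const_mul ((τ : ℂ) ^ (j + 1))⁻¹
          have h2 := ((ih (traceSum d θ) τ hτ (w - j) _
            (contDiff_faceSum (n := (w - j + 1 : ℕ)) (hg.pderivI_iterate_sub hj' _)) _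
            (mul_nonneg (pow_nonneg hsl _) hM0)
            (hM.faceSum_iterate hj' hM0 hg)).skew ((hker j).translate τ) 1).const_mul
              ((τ : ℂ) ^ (j + 1))⁻¹
          have hb := face_term_bound (d := d) hCpos.le hU.le hM0 hω.le hΩ0 hτ₀ hτ hj'
          exact (h1.mono hb).sub (h2.mono hb))
      have hftM : ∀ x ∈ Sd (d + 1), |(pderivI (d + 1) (Fin.last d))^[w + 1] g x| ≤ M := by
        intro x hx
        rw [← pderivL_replicate]
        exact hM _ (by simp; omega) (by simp) x hx
      have hftc : Continuous ((pderivI (d + 1) (Fin.last d))^[w + 1] g) :=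
        (ContDiff.pderivI_iterate (n := 0) (j := w + 1) (by simpa using hg) _).continuous
      have hintegrable := (((isTorusCoeff_ftS hftc hftM hτ₀ hτ).convolve (hker w)
        (Pi.single (Fin.last d) 1)).const_mul ((τ : ℂ) ^ (w + 1))⁻¹).mono
        (interior_term_bound (d := d) hCpos.le hM0 hω.le hΩ.le hτ' (by positivity) w)
      refine (((hfaces.add hintegrable).restrict_Qset θ).mono ?_).congr fun n => ?_
      · rw [← hK, Finset.sum_add_distrib, ← two_mul, ← Finset.mul_sum]
        have hgeom : ∑ j ∈ Finset.range (w + 1), (ω / Ω) ^ j ≤ (1 - ω / Ω)⁻¹ := by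
          rw [← tsum_geometric_of_lt_one hr0 hr1]
          exact (summable_geometric_of_lt_one hr0 hr1).sum_le_tsum _ fun j _ => by positivity
        calc _ ≤ K * (2 * (C * U * (ω / τ₀) * (2 ^ (d + 1 - 1) * Ω * τ⁻¹) ^ (w + 1) * M *
              (1 - ω / Ω)⁻¹) + C * (1 + 1 / τ₀) ^ (d + 1) *
                (2 ^ (d + 1 - 1) * Ω * τ⁻¹) ^ (w + 1) * M) := by gcongr
          _ = K * (0 + (2 * (C * U * (ω / τ₀)) * (1 - ω / Ω)⁻¹ + C * (1 + 1 / τ₀) ^ (d + 1))) *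
              (2 ^ (d + 1 - 1) * Ω * τ⁻¹) ^ (w + 1) * M := by ring
          _ ≤ _ := by gcongr
      · refine if_ctx_congr Iff.rfl (fun hn => ?_) fun _ => rfl
        have hlast : n (Fin.last d) ≠ 0 := by
          have := (last_eq_zero_iff hn).not.mpr hθ
          exact_mod_cast this
        have hne : (τ • fun i => (n i : ℝ)) (Fin.last d) ≠ 0 := by
          simp [hlast, hτ'.ne']
        rw [rem_succ_of_notMem hθ hg hne, freqInit_smul_intCast, freqSlant_smul_intCast]
        simp only [if_pos (intCast_mem_Qset_traceZero hn), if_pos (intCast_mem_Qset_traceSum hn),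
          Pi.smul_apply, smul_eq_mul, inv_pow_mul_intCast]
        congr 1
        · refine Finset.sum_congr rfl fun j _ => ?_
          have hexp : Complex.exp (-2 * π * Complex.I * (n (Fin.last d) * τ)) =
              Complex.exp (-(2 * π * Complex.I * ((τ * (n (Fin.last d) : ℝ) : ℝ) : ℂ))) := by
            congr 1
            push_cast
            ring
          rw [hexp]
          ring
        · have hdot : ∑ i, n i * (Pi.single (Fin.last d) 1 : Fin (d + 1) → ℤ) i
              = n (Fin.last d) := by
            simp [Pi.single_apply]
          rw [hdot]
          ring

end RemainderBound

section Assembly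

variable {d : ℕ}

/-- `alphaF` extends from sufficiently smooth functions to a linear functional on all functions. -/
theorem exists_isLinearMap_eq_alphaF (θ : Set (Fin d → ℝ)) (V : Fin d → Bool) (J : Fin d → ℕ) :
    ∃ a : ((Fin d → ℝ) → ℝ) → ℝ, IsLinearMap ℝ a ∧
      ∀ g, ContDiff ℝ (∑ k, J k : ℕ) g → a g = alphaF d θ V J g := by
  let S : Submodule ℝ ((Fin d → ℝ) → ℝ) :=
    { carrier := {g | ContDiff ℝ (∑ k, J k : ℕ) g}
      add_mem' := by
        simp only [Set.mem_ofPred_eq]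
        exact fun hf hg => hf.add hg
      zero_mem' := by
        simp only [Set.mem_ofPred_eq]
        exact contDiff_const
      smul_mem' := by
        simp only [Set.mem_ofPred_eq]
        exact fun c _ hf => hf.const_smul c }
  have hS : ∀ g, g ∈ S ↔ ContDiff ℝ (∑ k, J k : ℕ) g := fun g => Set.mem_ofPred
  let L : S →ₗ[ℝ] ℝ :=
    { toFun := fun g => alphaF d θ V J g.1
      map_add' := fun f g => alphaF_add θ V J ((hS f).1 f.2) ((hS g).1 g.2)
      map_smul' := fun c f => alphaF_smul θ V J c ((hS f).1 f.2) }
  obtain ⟨A, hA⟩ := L.exists_extend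
  exact ⟨A, A.isLinear, fun g hg => LinearMap.congr_fun hA ⟨g, (hS g).2 hg⟩⟩

theorem sum_fin_eq_sum_Jset {w : ℕ} (f : (Fin d → ℕ) → ℂ) :
    (∑ J : Fin d → Fin (w + 1), if ∑ k, (J k : ℕ) ≤ w then f (fun k => (J k : ℕ)) else 0) =
      ∑ J ∈ Jset d w, f J := by
  rw [← Finset.sum_filter]
  refine Finset.sum_bij (fun J _ k => (J k : ℕ)) ?_ ?_ ?_ ?_
  · intro J hJ
    simpa [mem_Jset] using hJ
  · intro J _ J' _ h
    funext k
    exact Fin.ext (congrFun h k)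
  · intro J hJ
    rw [mem_Jset] at hJ
    refine ⟨fun k => ⟨J k, Nat.lt_succ_of_le ((Finset.single_le_sum
      (fun _ _ => Nat.zero_le _) (Finset.mem_univ k)).trans hJ)⟩, ?_, rfl⟩
    simpa using hJ
  · intros
    rfl

/-- A derivative of order `l.length` is bounded on the simplex by the supremum over a set of
multi-indices containing that of the list `l`. -/
theorem abs_pderivL_le_iSup {p : (Fin d → ℕ) → Prop} {N : ℕ} (hp : ∀ β, p β → ∑ k, β k ≤ N)
    {g : (Fin d → ℝ) → ℝ} (hg : ContDiff ℝ N g) {l : List (Fin d)}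
    (hl : p fun i => l.count i) {x : Fin d → ℝ} (hx : x ∈ Sd d) :
    |pderivL d l g x| ≤ ⨆ β : {β : Fin d → ℕ // p β}, ⨆ x : Sd d, |pderivM d β.1 g x.1| := by
  have hfin : Finite {β : Fin d → ℕ // p β} :=
    Set.Finite.subset (Jset d N).finite_toSet fun β hβ => mem_Jset.2 (hp β hβ)
  have hlen : l.length ≤ N := sum_count_eq_length l ▸ hp _ hl
  have hgl : ContDiff ℝ l.length g := hg.of_le (by exact_mod_cast hlen)
  have hcont : Continuous (pderivL d l g) :=
    (ContDiff.pderivL (n := 0) l (by simpa using hgl)).continuous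
  have hbdd : BddAbove (Set.range fun x : Sd d => |pderivM d (fun i => l.count i) g x.1|) := by
    rw [← pderivL_eq_pderivM l hgl, ← Set.image_eq_range (fun x => |pderivL d l g x|) (Sd d)]
    exact ((isCompact_Sd d).image hcont.abs).bddAbove
  rw [pderivL_eq_pderivM l hgl]
  exact (le_ciSup hbdd ⟨x, hx⟩).trans
    (le_ciSup (f := fun β : {β : Fin d → ℕ // p β} => ⨆ x : Sd d, |pderivM d β.1 g x.1|)
      (Set.finite_range _).bddAbove ⟨_, hl⟩)

end Assembly

open Classical in
theorem stmt14 (d : ℕ) (hd : 1 ≤ d) :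
    ∃ α : Submodule ℝ (Fin d → ℝ) → (Fin d → Bool) → (Fin d → ℕ) →
        ((Fin d → ℝ) → ℝ) → ℝ,
    ∃ R : Submodule ℝ (Fin d → ℝ) → ℕ → ((Fin d → ℝ) → ℝ) → (Fin d → ℝ) → ℂ,
      -- the `α(θ,V,J)` are linear functionals
      (∀ θ V J, IsLinearMap ℝ (α θ V J)) ∧
      -- (i) the asymptotic expansion of the Fourier transform of `g χ_{S_d}` on `Q(θ)`
      (∀ w : ℕ, 1 ≤ w → ∀ g : (Fin d → ℝ) → ℝ, ContDiff ℝ (w + 1) g →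
        ∀ θ ∈ Theta d, ∀ ξ ∈ Qcone d θ,
          ft d (fun x => (((Sd d).indicator g x : ℝ) : ℂ)) ξ =
            (∑ V : Fin d → Bool, ∑ J : Fin d → Fin (w + 1),
              if (∑ k, (J k : ℕ)) ≤ w ∧ (∀ k, baseVec d V k ∈ θ → (J k : ℕ) = 0) then
                ((α θ V (fun k => (J k : ℕ)) g : ℝ) : ℂ) *
                  Complex.exp (-2 * π * Complex.I * (∑ i, lamV d V i * ξ i)) /
                  ∏ k, (if baseVec d V k ∈ θ then 1 else
                    (2 * π * Complex.I * ((∑ i, baseVec d V k i * ξ i : ℝ) : ℂ))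
                      ^ ((J k : ℕ) + 1))
              else 0)
            + R θ w g ξ) ∧
      -- (ii) the size estimate for the coefficients
      (∃ c : ℝ, ∀ θ ∈ Theta d, ∀ (V : Fin d → Bool) (J : Fin d → ℕ)
          (g : (Fin d → ℝ) → ℝ), ContDiff ℝ (((∑ k, J k) + 1 : ℕ)) g →
        |α θ V J g| ≤ c * 2 ^ ((d - 1) * ∑ k, J k) *
          ⨆ β : {β : Fin d → ℕ // (∑ k, β k) ≤ ∑ k, J k},
            ⨆ x : (Sd d), |pderivM d β.1 g x.1|) ∧
      -- (iii) the remainder estimate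
      (∀ Ω : ℝ, 1 / (2 * π) < Ω → ∀ τ₀ : ℝ, 0 < τ₀ →
        ∃ U : ℝ, 0 < U ∧ ∀ θ ∈ Theta d, ∀ τ : ℝ, τ₀ < τ → ∀ w : ℕ, 1 ≤ w →
          ∀ g : (Fin d → ℝ) → ℝ, ContDiff ℝ (w + 1) g →
            ∃ G : (Fin d → ℝ) → ℂ,
              (∀ (x : Fin d → ℝ) (m : Fin d → ℤ), G (x + fun i => (m i : ℝ)) = G x) ∧
              (∀ n : Fin d → ℤ,
                tFC d G n =
                  if (fun i => (n i : ℝ)) ∈ Qcone d θ then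
                    R θ w g (τ • fun i => (n i : ℝ)) else 0) ∧
              (∀ x : Fin d → ℝ,
                ‖G x‖ ≤ U * (2 ^ (d - 1) * Ω * τ⁻¹) ^ (w + 1) *
                  ⨆ β : {β : Fin d → ℕ //
                      w + 2 ≤ (∑ k, β k) + d ∧ (∑ k, β k) ≤ w + 1},
                    ⨆ x : (Sd d), |pderivM d β.1 g x.1|)) := by
  choose α hlin hα using fun θ : Submodule ℝ (Fin d → ℝ) =>
    exists_isLinearMap_eq_alphaF (θ : Set (Fin d → ℝ))
  refine ⟨α, fun θ w g ξ => rem d θ w g ξ, hlin, ?_, ⟨1, ?_⟩, ?_⟩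
  · intro w _ g hg θ _ ξ _
    refine sub_eq_iff_eq_add.1 ((sub_sub_cancel (ftS d g ξ) (mainSum d θ w g ξ)).trans ?_)
    rw [mainSum]
    refine Finset.sum_congr rfl fun V _ => ?_
    rw [← sum_fin_eq_sum_Jset]
    refine Finset.sum_congr rfl fun J _ => ?_
    rw [ite_and]
    refine ite_congr rfl (fun hJ => ?_) fun _ => rfl
    rw [hα θ V _ g (hg.of_le (by exact_mod_cast hJ.trans w.le_succ)), phase, mul_ite, mul_zero]
    refine ite_congr rfl (fun _ => ?_) fun _ => rfl
    simp only [mul_div_assoc, SetLike.mem_coe]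
  · intro θ _ V J g hg
    have hg' : ContDiff ℝ (∑ k, J k : ℕ) g := hg.of_le (by exact_mod_cast Nat.le_succ _)
    rw [hα θ V J g hg', one_mul, pow_mul]
    refine abs_alphaF_le θ V J hg' fun l hl x hx => ?_
    exact abs_pderivL_le_iSup (p := fun β => ∑ k, β k ≤ ∑ k, J k) (fun _ h => h) hg'
      ((sum_count_eq_length l).trans_le hl) hx
  · intro Ω hΩ τ₀ hτ₀
    obtain ⟨U, hU, h⟩ := exists_isTorusCoeff_rem d hΩ hτ₀
    refine ⟨U, hU, fun θ _ τ hτ w _ g hg => ?_⟩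
    have hg' : ContDiff ℝ (w + 1 : ℕ) g := by exact_mod_cast hg
    refine (h θ τ hτ w g hg' _ (Real.iSup_nonneg fun β => Real.iSup_nonneg fun x =>
      abs_nonneg _) fun l hl hl' x hx => ?_).exists_periodic
    refine abs_pderivL_le_iSup
      (p := fun β => w + 2 ≤ (∑ k, β k) + d ∧ (∑ k, β k) ≤ w + 1) (fun _ h => h.2) hg' ?_ hx
    simp only [sum_count_eq_length]
    exact ⟨hl, hl'⟩
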